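/- Let X ⊂ P^n be a smooth rational normal scroll of degree d and dimension k (so n = d + k - 1). Then h^0(X, N_{X/P^n}) = (d+k)^2 - k^2 - 3 and H^1(X, N_{X/P^n}) = 0. -/

import Mathlib

noncomputable section

open MvPolynomial

variable {𝕜 : Type*} [Field 𝕜] {σ : Type*}

/-- The localization of a module `M` over the polynomial ring at the powers of `g`;
for `M` the graded module corresponding to a quasi-coherent sheaf `F` on a closed
subscheme `X ⊆ P^n`, this is the module of sections of (twists of) `F` over `D(g) ∩ X`. -/
abbrev Loc (M : Type*) [AddCommGroup M] [Module (MvPolynomial σ 𝕜) M]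
    (g : MvPolynomial σ 𝕜) :=
  LocalizedModule (Submonoid.powers g) M

lemma isUnit_aux (M : Type*) [AddCommGroup M] [Module (MvPolynomial σ 𝕜) M]
    (g g' : MvPolynomial σ 𝕜) (h : g ∣ g') (s : Submonoid.powers g) :
    IsUnit (algebraMap (MvPolynomial σ 𝕜)
      (Module.End (MvPolynomial σ 𝕜) (Loc M g')) s) := by
  obtain ⟨n, hn⟩ := s.2
  obtain ⟨c, rfl⟩ := h
  have h1 : IsUnit (algebraMap (MvPolynomial σ 𝕜)
      (Module.End (MvPolynomial σ 𝕜) (Loc M (g * c))) ((g * c) ^ n)) :=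
    IsLocalizedModule.map_units
      (LocalizedModule.mkLinearMap (Submonoid.powers (g * c)) M) ⟨(g * c) ^ n, Submonoid.pow_mem _ (Submonoid.mem_powers _) n⟩
  rw [mul_pow, map_mul] at h1
  have hc : Commute (algebraMap (MvPolynomial σ 𝕜)
      (Module.End (MvPolynomial σ 𝕜) (Loc M (g * c))) (g ^ n))
      (algebraMap _ _ (c ^ n)) := (Commute.all (g ^ n) (c ^ n)).map _
  have := (hc.isUnit_mul_iff.mp h1).1
  simpa [← hn] using this
  
/-- The restriction map on sections, from `D(g)` to `D(g') ⊆ D(g)` for `g ∣ g'`. -/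
def resMap (M : Type*) [AddCommGroup M] [Module (MvPolynomial σ 𝕜) M]
    (g g' : MvPolynomial σ 𝕜) (h : g ∣ g') :
    Loc M g →ₗ[MvPolynomial σ 𝕜] Loc M g' :=
  LocalizedModule.lift _ (LocalizedModule.mkLinearMap (Submonoid.powers g') M)
    (isUnit_aux M g g' h)

/-- `y` is a degree-`t` section over `D(g)`, where `gr` describes the grading of the
module `M` and `dg` is the degree of `g`: it can be written as `m / gᵖ` with
`m ∈ M` homogeneous of degree `t + dg * p`. -/
def IsDeg (M : Type*) [AddCommGroup M] [Module (MvPolynomial σ 𝕜) M]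
    (gr : ℕ → Set M) (g : MvPolynomial σ 𝕜) (dg t : ℕ) (y : Loc M g) : Prop :=
  ∃ (p : ℕ) (m : M), m ∈ gr (t + dg * p) ∧ y = LocalizedModule.mk m ⟨g ^ p, Submonoid.pow_mem _ (Submonoid.mem_powers g) p⟩

end

open MvPolynomial

variable (𝕜 : Type*) [Field 𝕜] {σ : Type*}

/-- The graded pieces of the normal module `N = Hom(I, S/I)` of a closed subscheme
`X ⊂ P^n` with saturated homogeneous ideal `I`: a map `φ` has degree `d` if it raises
degrees of homogeneous elements by `d`. -/
def normalGr (I : Ideal (MvPolynomial σ 𝕜)) (d : ℕ) :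
    Set (↥I →ₗ[MvPolynomial σ 𝕜] MvPolynomial σ 𝕜 ⧸ I) :=
  {φ | ∀ (c : ℕ) (x : MvPolynomial σ 𝕜) (hx : x ∈ I), x.IsHomogeneous c →
    ∃ s : MvPolynomial σ 𝕜, s.IsHomogeneous (c + d) ∧ φ ⟨x, hx⟩ = Ideal.Quotient.mk I s}

/-- The degree-zero part of the graded normal module `N = Hom(I, S/I)`, i.e.
`H^0(X, N_{X/P^n})`: the `𝕜`-space of degree-preserving `S`-linear maps `I → S/I`. -/
noncomputable def normalDeg0 (I : Ideal (MvPolynomial σ 𝕜)) :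
    Submodule 𝕜 (↥I →ₗ[MvPolynomial σ 𝕜] MvPolynomial σ 𝕜 ⧸ I) where
  carrier := {φ | ∀ (c : ℕ) (x : MvPolynomial σ 𝕜) (hx : x ∈ I), x.IsHomogeneous c →
    ∃ s : MvPolynomial σ 𝕜, s.IsHomogeneous c ∧ φ ⟨x, hx⟩ = Ideal.Quotient.mk I s}
  zero_mem' := by
    intro c x hx h
    exact ⟨0, isHomogeneous_zero _ _ _, by simp⟩
  add_mem' := by
    intro φ ψ hφ hψ c x hx h
    obtain ⟨s₁, hs₁, e₁⟩ := hφ c x hx h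
    obtain ⟨s₂, hs₂, e₂⟩ := hψ c x hx h
    exact ⟨s₁ + s₂, hs₁.add hs₂, by
      rw [LinearMap.add_apply, e₁, e₂, ← RingHom.map_add]⟩
  smul_mem' := by
    intro a φ hφ c x hx h
    obtain ⟨s, hs, e⟩ := hφ c x hx h
    refine ⟨C a * s, hs.C_mul a, ?_⟩
    rw [LinearMap.smul_apply, e, ← MvPolynomial.smul_eq_C_mul,
      ← Ideal.Quotient.mkₐ_eq_mk 𝕜 I, map_smul]

/-- The homogeneous ideal of the rational normal scroll of type `(a_1, …, a_k)` in
`P^n`, `n = Σaᵢ + k - 1`: the kernel of the ring map sending the coordinate `z_{i,j}`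
(for `0 ≤ j ≤ aᵢ`) to `wᵢ sʲ t^(aᵢ - j)`. -/
noncomputable def scrollIdeal (k : ℕ) (a : Fin k → ℕ) :
    Ideal (MvPolynomial ((i : Fin k) × Fin (a i + 1)) 𝕜) :=
  RingHom.ker (MvPolynomial.aeval
    (fun p : (i : Fin k) × Fin (a i + 1) =>
      (X (Sum.inr p.1) * X (Sum.inl 0) ^ (p.2 : ℕ) * X (Sum.inl 1) ^ (a p.1 - (p.2 : ℕ)) :
        MvPolynomial (Fin 2 ⊕ Fin k) 𝕜))).toRingHom

namespace Scroll

section Weights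

variable {k : ℕ} (a : Fin k → ℕ)

/-- The homogeneous coordinates of the scroll of type `a`. -/
abbrev Var : Type := (i : Fin k) × Fin (a i + 1)

/-- The columns of the `2 × d` matrix whose minors cut out the scroll of type `a`. -/
abbrev Col : Type := (i : Fin k) × Fin (a i)

/-- The character lattice: exponents of `s` (with `t = 1`) and of the `wᵢ`. -/
abbrev Wt (k : ℕ) : Type := ℤ × (Fin k → ℤ)

variable {a}

/-- The weight of a coordinate. -/
def wt (p : Var a) : Wt k := ((p.2 : ℕ), Pi.single p.1 1)

/-- The entry of a column in the first row. -/
def lo (c : Col a) : Var a := ⟨c.1, c.2.castSucc⟩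

/-- The entry of a column in the second row. -/
def hi (c : Col a) : Var a := ⟨c.1, c.2.succ⟩

/-- The weight of the `2 × 2` minor on two columns. -/
def minorWt (c c' : Col a) : Wt k := wt (hi c) + wt (lo c')

@[simp] lemma wt_fst (p : Var a) : (wt p).1 = (p.2 : ℕ) := rfl
@[simp] lemma wt_snd (p : Var a) : (wt p).2 = Pi.single p.1 1 := rfl

lemma minorWt_fst (c c' : Col a) : (minorWt c c').1 = (c.2 : ℕ) + (c'.2 : ℕ) + 1 := by
  simp [minorWt, hi, lo]; ring

@[simp] lemma minorWt_snd (c c' : Col a) :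
    (minorWt c c').2 = Pi.single c.1 1 + Pi.single c'.1 1 := rfl

lemma wt_hi (c : Col a) : wt (hi c) = wt (lo c) + (1, 0) := by
  ext <;> simp [hi, lo]

lemma minorWt_comm (c c' : Col a) : minorWt c c' = minorWt c' c := by
  simp only [minorWt, wt_hi]; abel

variable (a)

/-- The weighted sum `∑ aᵢ mᵢ`. -/
def wsum (m : Fin k → ℤ) : ℤ := ∑ i, (a i : ℤ) * m i

lemma wsum_add (m m' : Fin k → ℤ) : wsum a (m + m') = wsum a m + wsum a m' := by
  simp [wsum, mul_add, Finset.sum_add_distrib]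

lemma wsum_nsmul (n : ℕ) (m : Fin k → ℤ) : wsum a (n • m) = n * wsum a m := by
  simp only [wsum, Finset.mul_sum]
  refine Finset.sum_congr rfl fun i _ => ?_
  simp; ring

@[simp] lemma wsum_zero : wsum a 0 = 0 := by simp [wsum]

@[simp] lemma wsum_single (i : Fin k) : wsum a (Pi.single i 1) = a i := by
  simp [wsum, Pi.single_apply]

lemma wsum_nonneg {m : Fin k → ℤ} (h : 0 ≤ m) : 0 ≤ wsum a m :=
  Finset.sum_nonneg fun i _ => mul_nonneg (by positivity) (h i)

/-- The weights of the homogeneous coordinate ring of the scroll. -/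
def cone : Set (Wt k) := {e | 0 ≤ e.2 ∧ 0 ≤ e.1 ∧ e.1 ≤ wsum a e.2}

/-- The weights of the homogeneous coordinate ring localized at a monomial of weight `e`. -/
def loc (e : Wt k) : Set (Wt k) := {u | ∃ n : ℕ, u + n • e ∈ cone a}

variable {a}

lemma add_mem_cone {e e' : Wt k} (h : e ∈ cone a) (h' : e' ∈ cone a) : e + e' ∈ cone a := by
  obtain ⟨h1, h2, h3⟩ := h
  obtain ⟨h1', h2', h3'⟩ := h'
  refine ⟨add_nonneg h1 h1', add_nonneg h2 h2', ?_⟩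
  rw [Prod.fst_add, Prod.snd_add, wsum_add]
  exact add_le_add h3 h3'

lemma zero_mem_cone : (0 : Wt k) ∈ cone a := ⟨le_rfl, le_rfl, by simp⟩

lemma nsmul_mem_cone {e : Wt k} (h : e ∈ cone a) (n : ℕ) : n • e ∈ cone a := by
  induction n with
  | zero => simpa using zero_mem_cone
  | succ n ih => rw [succ_nsmul]; exact add_mem_cone ih h

lemma wt_mem_cone (p : Var a) : wt p ∈ cone a := by
  refine ⟨by simp, by simp, ?_⟩
  have := p.2.is_lt
  simp; omega

lemma mem_loc_of_le {e u : Wt k} (he : e ∈ cone a) {n n' : ℕ} (hn : n ≤ n')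
    (h : u + n • e ∈ cone a) : u + n' • e ∈ cone a := by
  obtain ⟨m, rfl⟩ := Nat.exists_eq_add_of_le hn
  rw [add_nsmul, ← add_assoc]
  exact add_mem_cone h (nsmul_mem_cone he m)

lemma loc_mono {e e' : Wt k} (he' : e' ∈ cone a) : loc a e ⊆ loc a (e + e') := by
  rintro u ⟨n, hn⟩
  refine ⟨n, ?_⟩
  rw [nsmul_add, ← add_assoc]
  exact add_mem_cone hn (nsmul_mem_cone he' n)

lemma exists_nonneg_of_sum_eq_zero (c₀ : Col a) {m : Fin k → ℤ} (hm : ∑ i, m i = 0) :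
    ∃ l, 0 ≤ m l := by
  by_contra! h
  have := Finset.sum_neg (s := Finset.univ) (f := m) (fun i _ => h i) ⟨c₀.1, Finset.mem_univ _⟩
  omega

end Weights

end Scroll

namespace Scroll

section Combinatorics

variable {k : ℕ} {a : Fin k → ℕ}

lemma mem_loc_first {l : Fin k} (hl : 1 ≤ a l) {e : Wt k} (h : ∀ i, i ≠ l → 0 ≤ e.2 i)
    (h1 : 0 ≤ e.1) : e ∈ loc a (wt (⟨l, 0⟩ : Var a)) := by
  refine ⟨(e.2 l).natAbs + e.1.natAbs + (wsum a e.2).natAbs, fun i => ?_, ?_, ?_⟩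
  · by_cases hi : i = l
    · subst hi
      simp [-Nat.cast_natAbs]; omega
    · simpa [hi] using h i hi
  · simpa using h1
  · simp only [Prod.fst_add, Prod.snd_add, Prod.smul_fst, Prod.smul_snd, wsum_add, wsum_nsmul,
      wt_fst, wt_snd, wsum_single]
    have : ((((e.2 l).natAbs + e.1.natAbs + (wsum a e.2).natAbs : ℕ) : ℤ)) * 1 ≤
        (((e.2 l).natAbs + e.1.natAbs + (wsum a e.2).natAbs : ℕ) : ℤ) * a l :=
      mul_le_mul_of_nonneg_left (by exact_mod_cast hl) (by positivity)
    rw [mul_one] at this; simp only [Int.nsmul_eq_mul, Fin.val_zero, Nat.cast_zero, mul_zero]; omega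

lemma mem_loc_last {l : Fin k} (hl : 1 ≤ a l) {e : Wt k} (h : ∀ i, i ≠ l → 0 ≤ e.2 i)
    (h1 : e.1 ≤ wsum a e.2) : e ∈ loc a (wt (⟨l, Fin.last _⟩ : Var a)) := by
  have key : ((((e.2 l).natAbs + e.1.natAbs : ℕ) : ℤ)) * 1 ≤
        (((e.2 l).natAbs + e.1.natAbs : ℕ) : ℤ) * a l :=
      mul_le_mul_of_nonneg_left (by exact_mod_cast hl) (by positivity)
  rw [mul_one] at key
  refine ⟨(e.2 l).natAbs + e.1.natAbs, fun i => ?_, ?_, ?_⟩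
  · by_cases hi : i = l
    · subst hi
      simp [-Nat.cast_natAbs]; omega
    · simpa [hi] using h i hi
  · simp only [Prod.fst_add, Prod.smul_fst, wt_fst, Fin.val_last, Int.nsmul_eq_mul]
    omega
  · simp only [Prod.fst_add, Prod.snd_add, Prod.smul_fst, Prod.smul_snd, wsum_add, wsum_nsmul,
      wt_fst, wt_snd, wsum_single, Fin.val_last, Int.nsmul_eq_mul]
    omega

lemma nonneg_of_mem_loc {l : Fin k} {e : Wt k}
    (h : e ∈ loc a (wt (⟨l, 0⟩ : Var a) + wt (⟨l, Fin.last _⟩ : Var a))) {i : Fin k} (hi : i ≠ l) :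
    0 ≤ e.2 i := by
  obtain ⟨n, h, -⟩ := h
  simpa [hi] using h i

lemma mem_loc_of_mem_loc_mul {l : Fin k} {e : Wt k} (hl : 0 ≤ e.2 l) (p : Var a)
    (h0 : e ∈ loc a (wt (⟨l, 0⟩ : Var a) + wt p))
    (h1 : e ∈ loc a (wt (⟨l, Fin.last _⟩ : Var a) + wt p)) : e ∈ loc a (wt p) := by
  obtain ⟨n, h0⟩ := h0
  obtain ⟨n', h1⟩ := h1
  have h0 := mem_loc_of_le (add_mem_cone (wt_mem_cone _) (wt_mem_cone p)) (Nat.le_add_right n n') h0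
  have h1 := mem_loc_of_le (add_mem_cone (wt_mem_cone _) (wt_mem_cone p)) (Nat.le_add_left n' n) h1
  generalize n + n' = N at h0 h1
  obtain ⟨h0, h0', -⟩ := h0
  obtain ⟨-, -, h1⟩ := h1
  refine ⟨N, fun i => ?_, by simpa using h0', ?_⟩
  · by_cases hi : i = l
    · subst hi
      have : 0 ≤ (N • (Pi.single p.1 1 : Fin k → ℤ)) i := by
        have : 0 ≤ (Pi.single p.1 1 : Fin k → ℤ) := by simp
        exact nsmul_nonneg this N i
      simpa using add_nonneg hl this
    · simpa [hi] using h0 i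
  · simp only [Prod.fst_add, Prod.snd_add, Prod.smul_fst, Prod.smul_snd, wsum_add, wsum_nsmul,
      wt_fst, wt_snd, wsum_single, Fin.val_last, Int.nsmul_eq_mul, mul_add] at h1 ⊢
    omega

/-- The weights `u` at which the column `c` may be deformed regularly. -/
def colWts (c : Col a) : Set (Wt k) :=
  {u | ∑ i, u.2 i = 0 ∧ 0 ≤ u.2 + Pi.single c.1 1 ∧ 0 ≤ u.1 + (c.2 : ℕ) + 1 ∧
    u.1 + (c.2 : ℕ) ≤ wsum a u.2 + a c.1}

lemma add_minorWt_mem_cone {u : Wt k} {c : Col a} (hu : u ∈ colWts c) (c' : Col a) :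
    u + minorWt c c' ∈ cone a := by
  obtain ⟨-, h1, h2, h3⟩ := hu
  have := c'.2.is_lt
  refine ⟨?_, ?_, ?_⟩
  · rw [Prod.snd_add, minorWt_snd, ← add_assoc]
    exact add_nonneg h1 (by simp)
  · rw [Prod.fst_add, minorWt_fst]
    omega
  · simp only [Prod.fst_add, Prod.snd_add, minorWt_fst, minorWt_snd, wsum_add, wsum_single]
    omega

lemma exists_const_of_cone {R : Type*} (ha : ∀ i, 1 ≤ a i) (c₀ : Col a) {u : Wt k} (hu : ∑ i, u.2 i = 0)
    (v : Col a → R) (hv : ∀ c c', v c = v c' ∨ u + minorWt c c' ∈ cone a) :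
    ∃ κ, ∀ c, v c ≠ κ → u ∈ colWts c := by
  obtain ⟨l, hl⟩ := exists_nonneg_of_sum_eq_zero c₀ hu
  have hal := ha l
  let cf : Col a := ⟨l, ⟨0, by omega⟩⟩
  let cl : Col a := ⟨l, ⟨a l - 1, by omega⟩⟩
  have nn : ∀ c : Col a, 0 ≤ u.2 + (Pi.single c.1 1 + Pi.single l 1) → 0 ≤ u.2 + Pi.single c.1 1 := by
    intro c h i
    by_cases hi : i = l
    · subst hi
      have : 0 ≤ (Pi.single c.1 1 : Fin k → ℤ) i := (by simp : 0 ≤ (Pi.single c.1 1 : Fin k → ℤ)) i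
      simpa using add_nonneg hl this
    · simpa [hi] using h i
  have first : ∀ c, v c ≠ v cf → 0 ≤ u.2 + Pi.single c.1 1 ∧ 0 ≤ u.1 + (c.2 : ℕ) + 1 := by
    intro c hc
    obtain ⟨h1, h2, -⟩ := (hv c cf).resolve_left hc
    refine ⟨nn c h1, ?_⟩
    rw [Prod.fst_add, minorWt_fst] at h2
    simp [cf] at h2; omega
  have last : ∀ c, v c ≠ v cl → 0 ≤ u.2 + Pi.single c.1 1 ∧
      u.1 + (c.2 : ℕ) ≤ wsum a u.2 + a c.1 := by
    intro c hc
    obtain ⟨h1, -, h2⟩ := (hv c cl).resolve_left hc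
    refine ⟨nn c h1, ?_⟩
    simp only [Prod.fst_add, Prod.snd_add, minorWt_fst, minorWt_snd, wsum_add, wsum_single] at h2
    simp [cl] at h2; omega
  by_cases hκ : v cf = v cl
  · refine ⟨v cf, fun c hc => ?_⟩
    exact ⟨hu, (first c hc).1, (first c hc).2, (last c (hκ ▸ hc)).2⟩
  · have h0 : 0 ≤ u.2 := by
      intro i
      by_cases hi : i = l
      · subst hi; exact hl
      · simpa [hi, cl] using (first cl (Ne.symm hκ)).1 i
    have hz : u.2 = 0 := by
      funext i
      exact (Finset.sum_eq_zero_iff_of_nonneg (fun i _ => h0 i)).1 hu i (Finset.mem_univ _)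
    have bd : ∀ c : Col a, ((c.2 : ℕ) : ℤ) + 1 ≤ a c.1 := fun c => by exact_mod_cast c.2.is_lt
    rcases le_total u.1 0 with hx | hx
    · refine ⟨v cf, fun c hc => ⟨hu, (first c hc).1, (first c hc).2, ?_⟩⟩
      have := bd c
      rw [hz]; simp; omega
    · refine ⟨v cl, fun c hc => ⟨hu, (last c hc).1, ?_, (last c hc).2⟩⟩
      have := bd c
      omega

lemma exists_split {R : Type*} [AddCommGroup R] (c₀ : Col a) {l : Fin k} (hal : 1 ≤ a l) {u : Wt k}
    (hl : 0 ≤ u.2 l) (v : Col a → R) (hv0 : v c₀ = 0)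
    (hv : ∀ c c', v c = v c' ∨
      u + minorWt c c' ∈ loc a (wt (⟨l, 0⟩ : Var a) + wt (⟨l, Fin.last _⟩ : Var a))) :
    ∃ v0 v1 : Col a → R, v0 c₀ = 0 ∧ v1 c₀ = 0 ∧ (∀ c, v1 c - v0 c = v c) ∧
      (∀ c c', v0 c = v0 c' ∨ u + minorWt c c' ∈ loc a (wt (⟨l, 0⟩ : Var a))) ∧
      (∀ c c', v1 c = v1 c' ∨ u + minorWt c c' ∈ loc a (wt (⟨l, Fin.last _⟩ : Var a))) := by
  classical
  let κ := v ⟨l, ⟨0, by omega⟩⟩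
  have hκ : ∀ c, v c ≠ κ → 0 ≤ u.2 + Pi.single c.1 1 := by
    intro c hc i
    have h := (hv c _).resolve_left hc
    by_cases hi : i = l
    · subst hi
      have : 0 ≤ (Pi.single c.1 1 : Fin k → ℤ) i := (by simp : 0 ≤ (Pi.single c.1 1 : Fin k → ℤ)) i
      simpa using add_nonneg hl this
    · simpa [hi] using nonneg_of_mem_loc h hi
  let v0 : Col a → R := fun c => if 0 ≤ u.1 + (c.2 : ℕ) + 1 then κ - v c else 0
  let v1 : Col a → R := fun c => if 0 ≤ u.1 + (c.2 : ℕ) + 1 then 0 else v c - κ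
  have h01 : ∀ c, v1 c - v0 c = v c - κ := by
    intro c
    by_cases h : 0 ≤ u.1 + (c.2 : ℕ) + 1 <;> simp [v0, v1, h]
  have pos : ∀ c c' i, v c ≠ κ → 0 ≤ (u + minorWt c c').2 i := by
    intro c c' i hc
    rw [Prod.snd_add, minorWt_snd, ← add_assoc]
    exact add_nonneg (hκ c hc i) ((by simp : 0 ≤ (Pi.single c'.1 1 : Fin k → ℤ)) i)
  have m0 : ∀ c c', v0 c ≠ 0 → u + minorWt c c' ∈ loc a (wt (⟨l, 0⟩ : Var a)) := by
    intro c c' h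
    by_cases hx : 0 ≤ u.1 + (c.2 : ℕ) + 1
    · have hc : v c ≠ κ := fun h' => h (by simp [v0, h'])
      refine mem_loc_first hal (fun i _ => pos c c' i hc) ?_
      rw [Prod.fst_add, minorWt_fst]; omega
    · exact absurd (by simp [v0, hx]) h
  have m1 : ∀ c c', v1 c ≠ 0 → u + minorWt c c' ∈ loc a (wt (⟨l, Fin.last _⟩ : Var a)) := by
    intro c c' h
    by_cases hx : 0 ≤ u.1 + (c.2 : ℕ) + 1
    · exact absurd (by simp [v1, hx]) h
    · have hc : v c ≠ κ := fun h' => h (by simp [v1, h'])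
      refine mem_loc_last hal (fun i _ => pos c c' i hc) ?_
      have h1 := wsum_nonneg a (hκ c hc)
      have := c'.2.is_lt
      simp only [Prod.fst_add, Prod.snd_add, minorWt_fst, minorWt_snd, wsum_add, wsum_single]
        at h1 ⊢
      omega
  have gen : ∀ (w : Col a → R) (Q : Set (Wt k)), (∀ c c', w c ≠ 0 → u + minorWt c c' ∈ Q) →
      ∀ c c', w c - w c₀ = w c' - w c₀ ∨ u + minorWt c c' ∈ Q := by
    intro w Q h c c'
    by_cases hc : w c = 0
    · by_cases hc' : w c' = 0
      · left; rw [hc, hc']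
      · right; rw [minorWt_comm]; exact h c' c hc'
    · exact Or.inr (h c c' hc)
  refine ⟨fun c => v0 c - v0 c₀, fun c => v1 c - v1 c₀, sub_self _, sub_self _, fun c => ?_,
    gen v0 _ m0, gen v1 _ m1⟩
  have e1 := h01 c
  have e2 := h01 c₀
  rw [hv0] at e2
  calc v1 c - v1 c₀ - (v0 c - v0 c₀) = (v1 c - v0 c) - (v1 c₀ - v0 c₀) := by abel
    _ = v c := by rw [e1, e2]; abel

/-- At each weight, every Čech `1`-cocycle is a coboundary. -/
lemma exists_coboundary_at {R : Type*} [AddCommGroup R] (ha : ∀ i, 1 ≤ a i) (c₀ : Col a) {u : Wt k} (hu : ∑ i, u.2 i = 0)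
    (g : Var a → Var a → Col a → R) (h0 : ∀ p q, g p q c₀ = 0)
    (hg : ∀ p q c c', g p q c = g p q c' ∨ u + minorWt c c' ∈ loc a (wt p + wt q))
    (hcocycle : ∀ p q r c, g q r c - g p r c + g p q c = 0) :
    ∃ b : Var a → Col a → R, (∀ p, b p c₀ = 0) ∧
      (∀ p c c', b p c = b p c' ∨ u + minorWt c c' ∈ loc a (wt p)) ∧
      ∀ p q c, b q c - b p c = g p q c := by
  obtain ⟨l, hl⟩ := exists_nonneg_of_sum_eq_zero c₀ hu
  obtain ⟨v0, v1, h0c, h1c, hd, hv0, hv1⟩ :=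
    exists_split c₀ (ha l) hl (g ⟨l, 0⟩ ⟨l, Fin.last _⟩) (h0 _ _) (hg _ _)
  have heq : ∀ p c, g ⟨l, 0⟩ p c + v0 c = g ⟨l, Fin.last _⟩ p c + v1 c := by
    intro p c
    have h1 := hcocycle ⟨l, 0⟩ ⟨l, Fin.last _⟩ p c
    rw [← hd c] at h1
    rw [← sub_eq_zero, ← neg_eq_zero, ← h1]
    abel
  have sum_mem : ∀ (x : Var a) (p : Var a) (w : Col a → R),
      (∀ c c', w c = w c' ∨ u + minorWt c c' ∈ loc a (wt x)) →
      ∀ c c', g x p c + w c ≠ g x p c' + w c' → u + minorWt c c' ∈ loc a (wt x + wt p) := by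
    intro x p w hw c c' hne
    rcases hg x p c c' with h | h
    · rcases hw c c' with h' | h'
      · exact absurd (by rw [h, h']) hne
      · exact loc_mono (wt_mem_cone p) h'
    · exact h
  refine ⟨fun p c => g ⟨l, 0⟩ p c + v0 c, fun p => by simp [h0, h0c], fun p c c' => ?_,
    fun p q c => ?_⟩
  · by_cases hne : g ⟨l, 0⟩ p c + v0 c = g ⟨l, 0⟩ p c' + v0 c'
    · exact Or.inl hne
    · right
      refine mem_loc_of_mem_loc_mul ?_ p (sum_mem _ p v0 hv0 c c' hne) (sum_mem _ p v1 hv1 c c' ?_)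
      · have : 0 ≤ (Pi.single c.1 1 + Pi.single c'.1 1 : Fin k → ℤ) l :=
          add_nonneg ((by simp : 0 ≤ (Pi.single c.1 1 : Fin k → ℤ)) l)
            ((by simp : 0 ≤ (Pi.single c'.1 1 : Fin k → ℤ)) l)
        simpa using add_nonneg hl this
      · rwa [← heq, ← heq]
  · have h1 := hcocycle ⟨l, 0⟩ p q c
    dsimp only
    rw [← sub_eq_zero, ← neg_eq_zero, ← h1]
    abel

end Combinatorics

end Scroll

namespace Scroll

section Sections

variable {k : ℕ} {a : Fin k → ℕ} (𝕜 : Type*) [Field 𝕜]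

/-- Families of Laurent polynomials, normalized at the column `c₀`, which describe the homomorphisms
of degree `d` from the ideal of the scroll to the Laurent polynomials with weights in `Q`. -/
def sections (c₀ : Col a) (d : ℤ) (Q : Set (Wt k)) : Submodule 𝕜 (Col a → Wt k →₀ 𝕜) where
  carrier := {μ | μ c₀ = 0 ∧ (∀ c u, μ c u ≠ 0 → ∑ i, u.2 i = d) ∧
    ∀ c c' u, μ c u = μ c' u ∨ u + minorWt c c' ∈ Q}
  zero_mem' := ⟨rfl, fun c u h => absurd rfl h, fun _ _ _ => Or.inl rfl⟩
  add_mem' := by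
    rintro μ ν ⟨h1, h2, h3⟩ ⟨h1', h2', h3'⟩
    refine ⟨by simp [h1, h1'], fun c u h => ?_, fun c c' u => ?_⟩
    · by_cases hμ : μ c u = 0
      · exact h2' c u fun hν => h (by simp [hμ, hν])
      · exact h2 c u hμ
    · rcases h3 c c' u with h | h
      · rcases h3' c c' u with h' | h'
        · exact Or.inl (by simp [h, h'])
        · exact Or.inr h'
      · exact Or.inr h
  smul_mem' := by
    rintro r μ ⟨h1, h2, h3⟩
    refine ⟨by simp [h1], fun c u h => h2 c u fun h' => h (by simp [h']), fun c c' u => ?_⟩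
    exact (h3 c c' u).imp_left fun h => by simp [h]

variable {𝕜}

lemma exists_coboundary (ha : ∀ i, 1 ≤ a i) (c₀ : Col a)
    (g : Var a → Var a → Col a → Wt k →₀ 𝕜)
    (hg : ∀ p q, g p q ∈ sections 𝕜 c₀ 0 (loc a (wt p + wt q)))
    (hcocycle : ∀ p q r, g q r - g p r + g p q = 0) :
    ∃ b : Var a → Col a → Wt k →₀ 𝕜, (∀ p, b p ∈ sections 𝕜 c₀ 0 (loc a (wt p))) ∧
      ∀ p q, b q - b p = g p q := by
  classical
  have key : ∀ u : Wt k, ∃ b : Var a → Col a → 𝕜,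
      ((∀ p q c, g p q c u = 0) → b = 0) ∧ (∀ p c, b p c ≠ 0 → ∑ i, u.2 i = 0) ∧
      (∀ p, b p c₀ = 0) ∧
      (∀ p c c', b p c = b p c' ∨ u + minorWt c c' ∈ loc a (wt p)) ∧
      ∀ p q c, b q c - b p c = g p q c u := by
    intro u
    by_cases h0 : ∀ p q c, g p q c u = 0
    · exact ⟨0, fun _ => rfl, fun p c h => absurd rfl h, fun _ => rfl, fun _ _ _ => Or.inl rfl,
        fun p q c => by simp [h0]⟩
    · have h0' := h0
      push Not at h0'
      obtain ⟨p, q, c, hne⟩ := h0'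
      have hu := (hg p q).2.1 c u hne
      obtain ⟨b, h1, h2, h3⟩ := exists_coboundary_at ha c₀ hu (fun p q c => g p q c u)
        (fun p q => by simp [(hg p q).1]) (fun p q c c' => (hg p q).2.2 c c' u)
        (fun p q r c => by simpa using congrArg (fun f => f c u) (hcocycle p q r))
      exact ⟨b, fun h => absurd h h0, fun _ _ _ => hu, h1, h2, h3⟩
  choose b hb0 hbs hb1 hb2 hb3 using key
  let T : Finset (Wt k) := Finset.univ.biUnion fun x : Var a × Var a × Col a =>
    (g x.1 x.2.1 x.2.2).support
  have hT : ∀ p c u, b u p c ≠ 0 → u ∈ T := by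
    intro p c u h
    by_contra hu
    refine h (by rw [hb0 u]; · rfl
                 intro p q c
                 by_contra hne
                 exact hu (Finset.mem_biUnion.2 ⟨(p, q, c), Finset.mem_univ _, by simpa using hne⟩))
  let B : Var a → Col a → Wt k →₀ 𝕜 := fun p c => Finsupp.onFinset T (fun u => b u p c) (hT p c)
  refine ⟨B, fun p => ⟨?_, fun c u h => hbs u p c h, fun c c' u => hb2 u p c c'⟩, fun p q => ?_⟩
  · ext u; exact hb1 u p
  · funext c; ext u; exact hb3 u p q c

/-- Subtracting the value at `c₀`. -/
noncomputable def normalize (c₀ : Col a) : (Col a → Wt k →₀ 𝕜) →ₗ[𝕜] (Col a → Wt k →₀ 𝕜) where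
  toFun μ c := μ c - μ c₀
  map_add' μ ν := by funext c; simp only [Pi.add_apply]; abel
  map_smul' r μ := by funext c; simp [smul_sub]

variable (𝕜 a) in
/-- Families of Laurent polynomials regular column by column. -/
noncomputable def regular : Submodule 𝕜 (Col a → Wt k →₀ 𝕜) :=
  Submodule.pi Set.univ fun c => Finsupp.supported 𝕜 𝕜 (colWts c)

lemma mem_regular {μ : Col a → Wt k →₀ 𝕜} :
    μ ∈ regular a 𝕜 ↔ ∀ c u, μ c u ≠ 0 → u ∈ colWts c := by
  simp [regular, Submodule.mem_pi, Finsupp.mem_supported, Set.subset_def]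

lemma map_normalize_regular (ha : ∀ i, 1 ≤ a i) (c₀ : Col a) :
    (regular a 𝕜).map (normalize c₀) = sections 𝕜 c₀ 0 (cone a) := by
  classical
  apply le_antisymm
  · rintro _ ⟨μ, hμ, rfl⟩
    rw [SetLike.mem_coe, mem_regular] at hμ
    refine ⟨sub_self _, fun c u h => ?_, fun c c' u => ?_⟩
    · by_cases h1 : μ c u = 0
      · exact (hμ c₀ u fun h2 => h (by simp [normalize, h1, h2])).1
      · exact (hμ c u h1).1
    · by_cases h1 : μ c u = 0
      · by_cases h2 : μ c' u = 0
        · left; simp [normalize, h1, h2]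
        · right; rw [minorWt_comm]; exact add_minorWt_mem_cone (hμ c' u h2) c
      · exact Or.inr (add_minorWt_mem_cone (hμ c u h1) c')
  · intro μ hμ
    have key : ∀ u : Wt k, ∃ κ : 𝕜, ((∀ c, μ c u = 0) → κ = 0) ∧
        ∀ c, μ c u ≠ κ → u ∈ colWts c := by
      intro u
      by_cases h0 : ∀ c, μ c u = 0
      · exact ⟨0, fun _ => rfl, fun c h => absurd (h0 c) h⟩
      · have h0' := h0
        push Not at h0'
        obtain ⟨c, hne⟩ := h0'
        obtain ⟨κ, hκ⟩ := exists_const_of_cone ha c₀ (hμ.2.1 c u hne) (fun c => μ c u)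
          (fun c c' => hμ.2.2 c c' u)
        exact ⟨κ, fun h => absurd h h0, hκ⟩
    choose κ hκ0 hκ using key
    let f : Wt k →₀ 𝕜 := Finsupp.onFinset (Finset.univ.biUnion fun c => (μ c).support) κ (by
      intro u h
      by_contra hu
      refine h (hκ0 u fun c => ?_)
      by_contra hne
      exact hu (Finset.mem_biUnion.2 ⟨c, Finset.mem_univ _, by simpa using hne⟩))
    refine ⟨fun c => μ c - f, mem_regular.2 fun c u h => hκ u c ?_, ?_⟩
    · rw [Finsupp.sub_apply, sub_ne_zero] at h
      exact h
    · funext c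
      simp [normalize, hμ.1]

/-- The weights at which every column may be deformed. -/
def commonWts : Set (Wt k) := {u | u.2 = 0 ∧ -1 ≤ u.1 ∧ u.1 ≤ 1}

lemma mem_commonWts (ha : ∀ i, 1 ≤ a i) (c₀ : Col a) (u : Wt k) :
    (∀ c : Col a, u ∈ colWts c) ↔ u ∈ (commonWts : Set (Wt k)) := by
  constructor
  · intro h
    have hsum := (h c₀).1
    have hz : u.2 = 0 := by
      have hp : ∀ i, 0 ≤ u.2 i := by
        intro i
        by_contra! hi
        have hle : ∀ j, j ≠ i → 0 ≤ u.2 j := by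
          intro j hj
          simpa [hj] using (h ⟨i, ⟨0, ha i⟩⟩).2.1 j
        obtain ⟨j, -, hj⟩ : ∃ j ∈ Finset.univ, 0 < u.2 j := by
          by_contra! hcon
          have := Finset.sum_lt_sum (s := Finset.univ) (f := u.2) (g := fun _ => 0)
            (fun j hj => hcon j hj) ⟨i, Finset.mem_univ _, hi⟩
          simp [hsum] at this
        have hij : i ≠ j := fun e => by subst e; omega
        have := (h ⟨j, ⟨0, ha j⟩⟩).2.1 i
        simp [hij] at this
        omega
      funext i
      exact (Finset.sum_eq_zero_iff_of_nonneg (fun i _ => hp i)).1 hsum i (Finset.mem_univ _)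
    have h1 := (h ⟨c₀.1, ⟨0, ha _⟩⟩).2.2.1
    have h2 := (h ⟨c₀.1, ⟨a c₀.1 - 1, by have := ha c₀.1; omega⟩⟩).2.2.2
    rw [hz] at h2
    simp at h1 h2
    have := ha c₀.1
    exact ⟨hz, by omega, by omega⟩
  · rintro ⟨hz, h1, h2⟩ c
    have := c.2.is_lt
    refine ⟨by simp [hz], by simp [hz], by omega, ?_⟩
    rw [hz]; simp; omega

/-- An enumeration of the weights at which the column `c` may be deformed. -/
lemma bijective_colWts (c : Col a) :
    Function.Bijective fun x : (r : Fin k) × Fin (a r + 2) =>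
      (⟨((x.2 : ℕ) - (c.2 : ℕ) - 1, Pi.single x.1 1 - Pi.single c.1 1), by
        have := x.2.is_lt
        refine ⟨by simp, by simp, by simp only; omega, ?_⟩
        have : wsum a (Pi.single x.1 1 - Pi.single c.1 1 + Pi.single c.1 1) = a x.1 := by simp
        rw [wsum_add, wsum_single] at this
        simp only; omega⟩ : colWts c) := by
  constructor
  · rintro ⟨r, j⟩ ⟨r', j'⟩ h
    have h1 : ((j : ℕ) : ℤ) - (c.2 : ℕ) - 1 = (j' : ℕ) - (c.2 : ℕ) - 1 :=
      congrArg (fun u => (Subtype.val u).1) h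
    have h2 : (Pi.single r 1 : Fin k → ℤ) - Pi.single c.1 1 = Pi.single r' 1 - Pi.single c.1 1 :=
      congrArg (fun u => (Subtype.val u).2) h
    rw [sub_left_inj] at h2
    have hr : r = r' := by
      by_contra hne
      have := congrFun h2 r
      simp [hne] at this
    subst hr
    have hj : j = j' := Fin.ext (by omega)
    rw [hj]
  · rintro ⟨⟨x, m⟩, h0, h1, h2, h3⟩
    simp only at h0 h1 h2 h3
    have hs : ∑ i, (m + Pi.single c.1 1 : Fin k → ℤ) i = 1 := by simp [Finset.sum_add_distrib, h0]
    obtain ⟨r, -, hr⟩ : ∃ r ∈ Finset.univ, 0 < (m + Pi.single c.1 1 : Fin k → ℤ) r := by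
      by_contra! hcon
      have := Finset.sum_nonpos hcon
      omega
    have hm : m + Pi.single c.1 1 = Pi.single r 1 := by
      have hle : ∀ i, 0 ≤ (m + Pi.single c.1 1 - Pi.single r 1 : Fin k → ℤ) i := by
        intro i
        by_cases hi : i = r
        · subst hi; simp only [Pi.sub_apply, Pi.single_eq_same]; omega
        · simpa [hi] using h1 i
      have hz : ∑ i, (m + Pi.single c.1 1 - Pi.single r 1 : Fin k → ℤ) i = 0 := by
        simp [Finset.sum_add_distrib, h0]
      rw [← sub_eq_zero]
      funext i
      exact (Finset.sum_eq_zero_iff_of_nonneg (fun i _ => hle i)).1 hz i (Finset.mem_univ _)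
    have hw := congrArg (wsum a) hm
    rw [wsum_add, wsum_single, wsum_single] at hw
    refine ⟨⟨r, ⟨(x + (c.2 : ℕ) + 1).toNat, by omega⟩⟩, ?_⟩
    ext i
    · simp only; omega
    · simp [← hm]

lemma bijective_commonWts :
    Function.Bijective fun x : Fin 3 =>
      (⟨((x : ℕ) - 1, 0), rfl, by simp only; omega, by have := x.is_lt; simp only; omega⟩ :
        (commonWts : Set (Wt k))) := by
  constructor
  · intro x y h
    have h1 : ((x : ℕ) : ℤ) - 1 = (y : ℕ) - 1 := congrArg (fun u => (Subtype.val u).1) h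
    exact Fin.ext (by omega)
  · rintro ⟨⟨x, m⟩, h0, h1, h2⟩
    simp only at h0 h1 h2
    subst h0
    refine ⟨⟨(x + 1).toNat, by omega⟩, ?_⟩
    ext i
    · simp only; omega
    · rfl

lemma finrank_supported {S : Set (Wt k)} {ι : Type*} [Fintype ι] {f : ι → S}
    (hf : Function.Bijective f) :
    Module.Finite 𝕜 (Finsupp.supported 𝕜 𝕜 S) ∧ Module.Free 𝕜 (Finsupp.supported 𝕜 𝕜 S) ∧
      Module.finrank 𝕜 (Finsupp.supported 𝕜 𝕜 S) = Fintype.card ι := by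
  let e : Finsupp.supported 𝕜 𝕜 S ≃ₗ[𝕜] (ι →₀ 𝕜) :=
    (Finsupp.supportedEquivFinsupp S).trans (Finsupp.domLCongr (Equiv.ofBijective f hf).symm)
  exact ⟨Module.Finite.equiv e.symm, Module.Free.of_equiv e.symm, by rw [e.finrank_eq, Module.finrank_finsupp_self]⟩

/-- The normalized families attached to tuples of Laurent polynomials regular at the columns. -/
noncomputable def regularMap (c₀ : Col a) :
    (∀ c : Col a, Finsupp.supported 𝕜 𝕜 (colWts c)) →ₗ[𝕜] (Col a → Wt k →₀ 𝕜) :=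
  normalize c₀ ∘ₗ LinearMap.pi fun c => Submodule.subtype _ ∘ₗ LinearMap.proj c

lemma range_regularMap (ha : ∀ i, 1 ≤ a i) (c₀ : Col a) :
    LinearMap.range (regularMap (𝕜 := 𝕜) c₀) = sections 𝕜 c₀ 0 (cone a) := by
  rw [← map_normalize_regular ha]
  apply le_antisymm
  · rintro _ ⟨μ, rfl⟩
    exact ⟨fun c => μ c, fun c _ => (μ c).2, rfl⟩
  · rintro _ ⟨μ, hμ, rfl⟩
    exact ⟨fun c => ⟨μ c, hμ c (Set.mem_univ c)⟩, rfl⟩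

lemma mem_ker_regularMap (c₀ : Col a) (μ : ∀ c : Col a, Finsupp.supported 𝕜 𝕜 (colWts c)) :
    μ ∈ LinearMap.ker (regularMap (𝕜 := 𝕜) c₀) ↔ ∀ c, (μ c : Wt k →₀ 𝕜) = μ c₀ := by
  rw [LinearMap.mem_ker, funext_iff]
  exact forall_congr' fun c => sub_eq_zero

/-- The kernel of `regularMap` consists of the constant families. -/
noncomputable def kerRegularMap (ha : ∀ i, 1 ≤ a i) (c₀ : Col a) :
    LinearMap.ker (regularMap (𝕜 := 𝕜) c₀) ≃ₗ[𝕜]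
      Finsupp.supported 𝕜 𝕜 (commonWts : Set (Wt k)) where
  toFun μ := ⟨μ.1 c₀, fun u hu => (mem_commonWts ha c₀ u).1 fun c => by
    have h := (mem_ker_regularMap c₀ _).1 μ.2 c
    exact (μ.1 c).2 (by rw [h]; exact hu)⟩
  map_add' _ _ := rfl
  map_smul' _ _ := rfl
  invFun f := ⟨fun c => ⟨f, fun u hu => (mem_commonWts ha c₀ u).2 (f.2 hu) c⟩,
    (mem_ker_regularMap c₀ _).2 fun _ => rfl⟩
  left_inv μ := by
    ext c : 3
    exact ((mem_ker_regularMap c₀ _).1 μ.2 c).symm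
  right_inv _ := rfl

lemma finrank_sections (ha : ∀ i, 1 ≤ a i) (c₀ : Col a) :
    Module.finrank 𝕜 (sections 𝕜 c₀ 0 (cone a)) = ((∑ i, a i) + k) ^ 2 - k ^ 2 - 3 := by
  have := fun c : Col a => (finrank_supported (𝕜 := 𝕜) (bijective_colWts c)).1
  have := fun c : Col a => (finrank_supported (𝕜 := 𝕜) (bijective_colWts c)).2.1
  have h1 := LinearMap.finrank_range_add_finrank_ker
    (V := ∀ c : Col a, Finsupp.supported 𝕜 𝕜 (colWts c)) (regularMap (𝕜 := 𝕜) c₀)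
  rw [range_regularMap ha, (kerRegularMap ha c₀).finrank_eq,
    (finrank_supported bijective_commonWts).2.2, Module.finrank_pi_fintype] at h1
  simp only [(finrank_supported (𝕜 := 𝕜) (bijective_colWts _)).2.2, Fintype.card_sigma,
    Fintype.card_fin, Finset.sum_const, Finset.card_univ, Finset.sum_add_distrib,
    smul_eq_mul] at h1
  rw [Nat.eq_sub_of_add_eq h1]
  congr 1
  refine (Nat.sub_eq_of_eq_add ?_).symm
  ring

end Sections

end Scroll

namespace Scroll

section Ideal

open MvPolynomial

variable {k : ℕ} {a : Fin k → ℕ} (𝕜 : Type*) [Field 𝕜]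

/-- Laurent polynomials: the coordinate ring of the torus (with `t = 1`). -/
abbrev Lau (k : ℕ) : Type _ := AddMonoidAlgebra 𝕜 (Wt k)

/-- The weight of a monomial. -/
noncomputable def mwt : (Var a →₀ ℕ) →+ Wt k :=
  Finsupp.liftAddHom fun p => multiplesHom _ (wt p)

variable {𝕜}

@[simp] lemma mwt_single (p : Var a) (n : ℕ) : mwt (Finsupp.single p n) = n • wt p := by
  simp [mwt]

lemma mwt_mem_cone (s : Var a →₀ ℕ) : mwt s ∈ cone a := by
  induction s using Finsupp.induction_linear with
  | zero => simpa using zero_mem_cone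
  | add s t hs ht => rw [map_add]; exact add_mem_cone hs ht
  | single p n => rw [mwt_single]; exact nsmul_mem_cone (wt_mem_cone p) n

lemma sum_mwt (s : Var a →₀ ℕ) : ∑ i, (mwt s).2 i = s.degree := by
  induction s using Finsupp.induction_linear with
  | zero => simp
  | add s t hs ht => simp [Finset.sum_add_distrib, hs, ht]
  | single p n => simp [← Finset.mul_sum]

lemma exists_eq_single_add_of_ne_zero (f : Wt k →+ ℤ) {s : Var a →₀ ℕ} (h : f (mwt s) ≠ 0) :
    ∃ p s', s = Finsupp.single p 1 + s' ∧ f (wt p) ≠ 0 := by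
  by_contra! hcon
  apply h
  have : ∀ p ∈ s.support, f (wt p) = 0 := fun p hp => hcon p (s - Finsupp.single p 1) (by
    rw [add_tsub_cancel_of_le]
    rw [Finsupp.single_le_iff]
    exact Nat.one_le_iff_ne_zero.2 (Finsupp.mem_support_iff.1 hp))
  rw [mwt, Finsupp.liftAddHom_apply, map_finsuppSum]
  refine Finset.sum_eq_zero fun p hp => ?_
  simp only [multiplesHom_apply, map_nsmul, this p hp, smul_zero]

variable (𝕜) in
/-- The monomial parametrization of the scroll. -/
noncomputable def toLau : MvPolynomial (Var a) 𝕜 →ₐ[𝕜] Lau 𝕜 k :=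
  aeval fun p => AddMonoidAlgebra.single (wt p) 1

@[simp] lemma toLau_X (p : Var a) : toLau 𝕜 (X p) = AddMonoidAlgebra.single (wt p) 1 :=
  aeval_X _ _

lemma toLau_monomial (s : Var a →₀ ℕ) (r : 𝕜) :
    toLau 𝕜 (monomial s r) = AddMonoidAlgebra.single (mwt s) r := by
  induction s using Finsupp.induction_linear generalizing r with
  | zero => 
    rw [map_zero, ← C_apply, ← algebraMap_eq, AlgHom.commutes]
    rfl
  | add s t hs ht =>
    rw [← mul_one r, ← monomial_mul, map_mul, hs, ht, AddMonoidAlgebra.single_mul_single, map_add]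
  | single p n =>
    rw [mwt_single, ← mul_one r, ← C_mul_monomial, ← X_pow_eq_monomial, C_mul', map_smul, map_pow,
      toLau_X, AddMonoidAlgebra.single_pow, one_pow, AddMonoidAlgebra.smul_single']

variable (𝕜) in
/-- The `2 × 2` minor on two columns. -/
noncomputable def minor (c c' : Col a) : MvPolynomial (Var a) 𝕜 :=
  X (hi c) * X (lo c') - X (lo c) * X (hi c')

variable (a 𝕜) in
/-- The ideal of `2 × 2` minors. -/
noncomputable def minorIdeal : Ideal (MvPolynomial (Var a) 𝕜) :=
  Ideal.span (Set.range fun x : Col a × Col a => minor 𝕜 x.1 x.2)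

variable (𝕜) in
/-- The class of a monomial modulo the minors. -/
noncomputable def mono (s : Var a →₀ ℕ) : MvPolynomial (Var a) 𝕜 ⧸ minorIdeal a 𝕜 :=
  Ideal.Quotient.mk _ (monomial s 1)

lemma mono_add (s t : Var a →₀ ℕ) : mono 𝕜 (s + t) = mono 𝕜 s * mono 𝕜 t := by
  simp [mono, ← map_mul, monomial_mul]

lemma mono_swap (c c' : Col a) :
    mono 𝕜 (Finsupp.single (hi c) 1 + Finsupp.single (lo c') 1) =
      mono 𝕜 (Finsupp.single (lo c) 1 + Finsupp.single (hi c') 1) := by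
  rw [mono, mono, Ideal.Quotient.eq]
  have : minor 𝕜 c c' ∈ minorIdeal a 𝕜 := Ideal.subset_span ⟨(c, c'), rfl⟩
  rwa [minor, X, X, X, X, monomial_mul, monomial_mul, one_mul] at this

variable (𝕜) in
lemma exists_mono_up (N : ℕ) (i : Fin k) (j j' : Fin (a i + 1)) (hN : (j' : ℕ) + N = j)
    (s t : Var a →₀ ℕ)
    (h : mwt (Finsupp.single ⟨i, j'⟩ 1 + s) = mwt (Finsupp.single ⟨i, j⟩ 1 + t)) :
    ∃ s', mono 𝕜 (Finsupp.single ⟨i, j'⟩ 1 + s) = mono 𝕜 (Finsupp.single ⟨i, j⟩ 1 + s') ∧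
      mwt (Finsupp.single ⟨i, j'⟩ 1 + s) = mwt (Finsupp.single ⟨i, j⟩ 1 + s') := by
  induction N generalizing j' s with
  | zero =>
    obtain rfl : j' = j := Fin.ext (by omega)
    exact ⟨s, rfl, rfl⟩
  | succ N ih =>
    obtain ⟨⟨l, m⟩, s, rfl, hm⟩ : ∃ p s', s = Finsupp.single p 1 + s' ∧
        AddMonoidHom.fst ℤ (Fin k → ℤ) (wt p) ≠ 0 := by
      refine exists_eq_single_add_of_ne_zero _ ?_
      have h1 := congrArg Prod.fst h
      have h2 := (mwt_mem_cone t).2.1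
      simp only [map_add, mwt_single, one_smul, Prod.fst_add, wt_fst] at h1
      simp only [AddMonoidHom.coe_fst]
      omega
    have hm : (m : ℕ) ≠ 0 := by simpa using hm
    let c : Col a := ⟨i, ⟨j', by have := j.is_lt; omega⟩⟩
    let c' : Col a := ⟨l, ⟨m - 1, by have := m.is_lt; omega⟩⟩
    have e1 : (⟨i, j'⟩ : Var a) = lo c := rfl
    have e2 : (⟨l, m⟩ : Var a) = hi c' := by
      simp only [hi, c']; congr; ext; simp; omega
    have hw : mwt (Finsupp.single (⟨i, j'⟩ : Var a) 1 + (Finsupp.single ⟨l, m⟩ 1 + s)) =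
        mwt (Finsupp.single (hi c) 1 + (Finsupp.single (lo c') 1 + s)) := by
      simp only [map_add, mwt_single, one_smul, e1, e2, wt_hi]; abel
    have hq : mono 𝕜 (Finsupp.single (⟨i, j'⟩ : Var a) 1 + (Finsupp.single ⟨l, m⟩ 1 + s)) =
        mono 𝕜 (Finsupp.single (hi c) 1 + (Finsupp.single (lo c') 1 + s)) := by
      rw [e1, e2, ← add_assoc, ← add_assoc, mono_add, ← mono_swap, ← mono_add]
    rw [hw, hq]
    exact ih c.2.succ (by simp [c]; omega) _ (hw ▸ h)

variable (𝕜) in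
lemma exists_mono_down (N : ℕ) (i : Fin k) (j j' : Fin (a i + 1)) (hN : (j : ℕ) + N = j')
    (s t : Var a →₀ ℕ)
    (h : mwt (Finsupp.single ⟨i, j'⟩ 1 + s) = mwt (Finsupp.single ⟨i, j⟩ 1 + t)) :
    ∃ s', mono 𝕜 (Finsupp.single ⟨i, j'⟩ 1 + s) = mono 𝕜 (Finsupp.single ⟨i, j⟩ 1 + s') ∧
      mwt (Finsupp.single ⟨i, j'⟩ 1 + s) = mwt (Finsupp.single ⟨i, j⟩ 1 + s') := by
  induction N generalizing j' s with
  | zero =>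
    obtain rfl : j' = j := Fin.ext (by omega)
    exact ⟨s, rfl, rfl⟩
  | succ N ih =>
    let f : Wt k →+ ℤ :=
      { toFun := fun u => wsum a u.2 - u.1
        map_zero' := by simp
        map_add' := fun u v => by simp only [Prod.snd_add, Prod.fst_add, wsum_add]; ring }
    obtain ⟨⟨l, m⟩, s, rfl, hm⟩ : ∃ p s', s = Finsupp.single p 1 + s' ∧ f (wt p) ≠ 0 := by
      refine exists_eq_single_add_of_ne_zero _ ?_
      have h1 := congrArg Prod.fst h
      have h2 := congrArg (fun u => wsum a u.2) h
      have h3 := (mwt_mem_cone t).2.2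
      simp only [map_add, mwt_single, one_smul, Prod.fst_add, Prod.snd_add, wt_fst, wt_snd,
        wsum_add] at h1 h2
      simp only [f, AddMonoidHom.coe_mk, ZeroHom.coe_mk]
      omega
    have hm : (m : ℕ) ≠ a l := by
      intro h; apply hm; simp [f, h]
    have hm' := m.is_lt
    have hj' := j'.is_lt
    let c : Col a := ⟨i, ⟨j' - 1, by omega⟩⟩
    let c' : Col a := ⟨l, ⟨m, by omega⟩⟩
    have e1 : (⟨i, j'⟩ : Var a) = hi c := by
      simp only [hi, c]; congr; ext; simp; omega
    have e2 : (⟨l, m⟩ : Var a) = lo c' := rfl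
    have hw : mwt (Finsupp.single (⟨i, j'⟩ : Var a) 1 + (Finsupp.single ⟨l, m⟩ 1 + s)) =
        mwt (Finsupp.single (lo c) 1 + (Finsupp.single (hi c') 1 + s)) := by
      simp only [map_add, mwt_single, one_smul, e1, e2, wt_hi]; abel
    have hq : mono 𝕜 (Finsupp.single (⟨i, j'⟩ : Var a) 1 + (Finsupp.single ⟨l, m⟩ 1 + s)) =
        mono 𝕜 (Finsupp.single (lo c) 1 + (Finsupp.single (hi c') 1 + s)) := by
      rw [e1, e2, ← add_assoc, ← add_assoc, mono_add, mono_swap, ← mono_add]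
    rw [hw, hq]
    exact ih c.2.castSucc (by simp [c]; omega) _ (hw ▸ h)

/-- Straightening: monomials of the same weight are congruent modulo the minors. -/
lemma mono_eq_of_mwt_eq {s t : Var a →₀ ℕ} (h : mwt s = mwt t) : mono 𝕜 s = mono 𝕜 t := by
  obtain ⟨n, hn⟩ : ∃ n, t.degree = n := ⟨_, rfl⟩
  have hn' : s.degree = n := by
    have := sum_mwt s
    rw [h, sum_mwt, hn] at this
    exact_mod_cast this.symm
  induction n generalizing s t with
  | zero =>
    rw [(Finsupp.degree_eq_zero_iff s).1 hn', (Finsupp.degree_eq_zero_iff t).1 hn]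
  | succ n ih =>
    obtain ⟨⟨i, j⟩, t, rfl⟩ : ∃ p t', t = Finsupp.single p 1 + t' := by
      obtain ⟨p, t', h, -⟩ := exists_eq_single_add_of_ne_zero
        (∑ i, (Pi.evalAddMonoidHom (fun _ => ℤ) i).comp (AddMonoidHom.snd ℤ (Fin k → ℤ)))
        (s := t) (by
          have := sum_mwt t
          simp only [AddMonoidHom.finsetSum_apply, AddMonoidHom.comp_apply, AddMonoidHom.coe_snd,
            Pi.evalAddMonoidHom_apply]
          rw [this, hn]
          positivity)
      exact ⟨p, t', h⟩
    obtain ⟨⟨i', j'⟩, s, rfl, hi⟩ := exists_eq_single_add_of_ne_zero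
      ((Pi.evalAddMonoidHom (fun _ => ℤ) i).comp (AddMonoidHom.snd ℤ (Fin k → ℤ)))
      (s := s) (by
        have h1 := (mwt_mem_cone t).1 i
        simp only [AddMonoidHom.comp_apply, AddMonoidHom.coe_snd, Pi.evalAddMonoidHom_apply, h,
          map_add, mwt_single, one_smul, wt_snd, Pi.single_eq_same, Pi.zero_apply] at h1 ⊢
        omega)
    obtain rfl : i = i' := by
      by_contra hne
      simp [hne] at hi
    obtain ⟨s', e1, e2⟩ : ∃ s', mono 𝕜 (Finsupp.single ⟨i, j'⟩ 1 + s) =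
        mono 𝕜 (Finsupp.single ⟨i, j⟩ 1 + s') ∧
        mwt (Finsupp.single ⟨i, j'⟩ 1 + s) = mwt (Finsupp.single ⟨i, j⟩ 1 + s') := by
      rcases le_total (j' : ℕ) j with hj | hj
      · exact exists_mono_up 𝕜 (j - j') i j j' (by omega) s t h
      · exact exists_mono_down 𝕜 (j' - j) i j j' (by omega) s t h
    have hst : mwt s' = mwt t := by
      rw [h, map_add, map_add] at e2
      exact (add_left_cancel e2).symm
    have ht : t.degree = n := by
      rw [map_add, Finsupp.degree_single] at hn
      omega
    rw [e1, mono_add, mono_add, ih hst ht]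
    have := sum_mwt s'
    rw [hst, sum_mwt, ht] at this
    exact_mod_cast this.symm

lemma ker_toLau_le : RingHom.ker (toLau 𝕜 : MvPolynomial (Var a) 𝕜 →ₐ[𝕜] Lau 𝕜 k) ≤
    minorIdeal a 𝕜 := by
  classical
  let Ψ : Lau 𝕜 k →ₗ[𝕜] MvPolynomial (Var a) 𝕜 ⧸ minorIdeal a 𝕜 :=
    (Finsupp.linearCombination 𝕜 fun u =>
      if h : ∃ s : Var a →₀ ℕ, mwt s = u then mono 𝕜 h.choose else 0) ∘ₗ
        (AddMonoidAlgebra.coeffLinearEquiv 𝕜).toLinearMap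
  have key : ∀ f, Ψ (toLau 𝕜 f) = Ideal.Quotient.mk _ f := by
    intro f
    induction f using MvPolynomial.induction_on' with
    | monomial s r =>
      have h : ∃ t : Var a →₀ ℕ, mwt t = mwt s := ⟨s, rfl⟩
      have e : Ψ (AddMonoidAlgebra.single (mwt s) r) = r • mono 𝕜 h.choose := by
        simp only [Ψ, LinearMap.comp_apply]
        refine (Finsupp.linearCombination_single 𝕜 r (mwt s)).trans ?_
        rw [dif_pos h]
      rw [toLau_monomial, e, mono_eq_of_mwt_eq h.choose_spec, mono,
        ← Ideal.Quotient.mkₐ_eq_mk 𝕜, ← map_smul, smul_monomial, smul_eq_mul, mul_one]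
    | add f g hf hg => simp [map_add, hf, hg]
  intro f hf
  rw [RingHom.mem_ker] at hf
  rw [← Ideal.Quotient.eq_zero_iff_mem, ← key f, hf, map_zero]

lemma minorIdeal_le : minorIdeal a 𝕜 ≤ scrollIdeal 𝕜 k a := by
  rw [minorIdeal, Ideal.span_le]
  rintro _ ⟨⟨c, c'⟩, rfl⟩
  rw [SetLike.mem_coe, scrollIdeal, RingHom.mem_ker]
  have h : ∀ c : Col a, a c.1 - (c.2 : ℕ) = a c.1 - ((c.2 : ℕ) + 1) + 1 := fun c => by
    have := c.2.is_lt; omega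
  simp only [minor, AlgHom.toRingHom_eq_coe, RingHom.coe_coe, map_sub, map_mul, aeval_X, hi, lo,
    Fin.val_succ, Fin.val_castSucc, h c, h c', pow_succ]
  ring

lemma scrollIdeal_le : scrollIdeal 𝕜 k a ≤
    RingHom.ker (toLau 𝕜 : MvPolynomial (Var a) 𝕜 →ₐ[𝕜] Lau 𝕜 k) := by
  let θ : MvPolynomial (Fin 2 ⊕ Fin k) 𝕜 →ₐ[𝕜] Lau 𝕜 k :=
    aeval (Sum.elim (fun x => if x = 0 then AddMonoidAlgebra.single (1, 0) 1 else 1)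
      fun i => AddMonoidAlgebra.single (0, Pi.single i 1) 1)
  have key : toLau 𝕜 = θ.comp (aeval fun p : Var a => X (Sum.inr p.1) *
      X (Sum.inl 0) ^ (p.2 : ℕ) * X (Sum.inl 1) ^ (a p.1 - (p.2 : ℕ))) := by
    refine algHom_ext fun p => ?_
    simp [θ, AddMonoidAlgebra.single_pow, AddMonoidAlgebra.single_mul_single, wt]
  intro f hf
  rw [scrollIdeal, RingHom.mem_ker] at hf
  rw [RingHom.mem_ker, key, AlgHom.comp_apply]
  exact (congrArg θ hf).trans (map_zero θ)

lemma scrollIdeal_eq : scrollIdeal 𝕜 k a = minorIdeal a 𝕜 :=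
  le_antisymm (scrollIdeal_le.trans ker_toLau_le) minorIdeal_le

lemma toLau_eq_zero_iff {f : MvPolynomial (Var a) 𝕜} : toLau 𝕜 f = 0 ↔ f ∈ scrollIdeal 𝕜 k a :=
  ⟨fun h => minorIdeal_le (ker_toLau_le h), fun h => scrollIdeal_le h⟩

lemma exists_mwt_eq {e : Wt k} (he : e ∈ cone a) : ∃ s : Var a →₀ ℕ, mwt s = e := by
  obtain ⟨n, hn⟩ : ∃ n : ℕ, ∑ i, e.2 i = n :=
    ⟨_, (Int.toNat_of_nonneg (Finset.sum_nonneg fun i _ => he.1 i)).symm⟩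
  induction n generalizing e with
  | zero =>
    obtain ⟨h1, h2, h3⟩ := he
    have hz : e.2 = 0 := by
      funext i
      exact (Finset.sum_eq_zero_iff_of_nonneg (fun i _ => h1 i)).1 (by simpa using hn) i
        (Finset.mem_univ _)
    rw [hz, wsum_zero] at h3
    exact ⟨0, Prod.ext (by simp; omega) (by simp [hz])⟩
  | succ n ih =>
    obtain ⟨h1, h2, h3⟩ := he
    obtain ⟨i, -, hi⟩ : ∃ i ∈ Finset.univ, 0 < e.2 i := by
      by_contra! hcon
      have := Finset.sum_nonpos hcon
      omega
    have h1' : 0 ≤ e.2 - Pi.single i 1 := by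
      intro j
      by_cases hj : j = i
      · subst hj; simp; omega
      · simpa [hj] using h1 j
    have hw : wsum a (e.2 - Pi.single i 1 + Pi.single i 1) = wsum a e.2 := by simp
    rw [wsum_add, wsum_single] at hw
    have hw' := wsum_nonneg a h1'
    let p : Var a := ⟨i, ⟨min e.1.toNat (a i), by omega⟩⟩
    have hp : (wt p).1 = min e.1 (a i) := by simp [p]; omega
    obtain ⟨s, hs⟩ := ih (e := e - wt p) ⟨h1', by rw [Prod.fst_sub, hp]; omega, by
      rw [Prod.fst_sub, hp, Prod.snd_sub, wt_snd]; simp only [p]; omega⟩ (by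
      simp [p, hn])
    exact ⟨Finsupp.single p 1 + s, by rw [map_add, hs, mwt_single, one_smul]; abel⟩

lemma exists_homogeneous {n : ℕ} {f : Lau 𝕜 k}
    (hf : ∀ u, f.coeff u ≠ 0 → u ∈ cone a ∧ ∑ i, u.2 i = n) :
    ∃ x : MvPolynomial (Var a) 𝕜, x.IsHomogeneous n ∧ toLau 𝕜 x = f := by
  have : ∀ u, ∃ s : Var a →₀ ℕ, u ∈ f.coeff.support → mwt s = u := by
    intro u
    by_cases hu : u ∈ f.coeff.support
    · obtain ⟨s, hs⟩ := exists_mwt_eq (hf u (Finsupp.mem_support_iff.1 hu)).1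
      exact ⟨s, fun _ => hs⟩
    · exact ⟨0, fun h => absurd h hu⟩
  choose s hs using this
  refine ⟨∑ u ∈ f.coeff.support, monomial (s u) (f.coeff u),
    IsHomogeneous.sum _ _ _ fun u hu => isHomogeneous_monomial _ ?_, ?_⟩
  · have h := (hf u (Finsupp.mem_support_iff.1 hu)).2
    rw [← hs u hu, sum_mwt] at h
    exact_mod_cast h
  · rw [map_sum]
    refine Eq.trans (Finset.sum_congr rfl fun u hu => ?_) (AddMonoidAlgebra.sum_coeff_single f)
    rw [toLau_monomial, hs u hu]

lemma exists_mem_support_of_coeff_toLau_ne_zero {x : MvPolynomial (Var a) 𝕜} {u : Wt k}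
    (hu : (toLau 𝕜 x).coeff u ≠ 0) : ∃ s ∈ x.support, mwt s = u := by
  rw [← support_sum_monomial_coeff x, map_sum, AddMonoidAlgebra.coeff_sum,
    Finsupp.finsetSum_apply] at hu
  obtain ⟨s, hs, hne⟩ := Finset.exists_ne_zero_of_sum_ne_zero hu
  rw [toLau_monomial, AddMonoidAlgebra.coeff_single] at hne
  refine ⟨s, hs, ?_⟩
  by_contra h
  exact hne (Finsupp.single_eq_of_ne (Ne.symm h))

lemma mem_cone_of_coeff_toLau_ne_zero {x : MvPolynomial (Var a) 𝕜} {u : Wt k}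
    (hu : (toLau 𝕜 x).coeff u ≠ 0) : u ∈ cone a := by
  obtain ⟨s, -, rfl⟩ := exists_mem_support_of_coeff_toLau_ne_zero hu
  exact mwt_mem_cone s

lemma sum_eq_of_coeff_toLau_ne_zero {n : ℕ} {x : MvPolynomial (Var a) 𝕜} (hx : x.IsHomogeneous n)
    {u : Wt k} (hu : (toLau 𝕜 x).coeff u ≠ 0) : ∑ i, u.2 i = n := by
  obtain ⟨s, hs, rfl⟩ := exists_mem_support_of_coeff_toLau_ne_zero hu
  rw [sum_mwt, ← hx (mem_support_iff.1 hs), Finsupp.degree_eq_weight_one]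
  rfl

end Ideal

end Scroll

namespace Scroll

section Normal

open MvPolynomial
open AddMonoidAlgebra (single)

variable {𝕜 : Type*} [Field 𝕜] {k : ℕ} {a : Fin k → ℕ}

noncomputable instance : Module (MvPolynomial (Var a) 𝕜) (Lau 𝕜 k) :=
  Module.compHom _ (toLau 𝕜).toRingHom

lemma smul_eq (x : MvPolynomial (Var a) 𝕜) (f : Lau 𝕜 k) : x • f = toLau 𝕜 x * f := rfl

instance : IsScalarTower 𝕜 (MvPolynomial (Var a) 𝕜) (Lau 𝕜 k) :=
  ⟨fun r x f => by rw [smul_eq, smul_eq, map_smul, smul_mul_assoc]⟩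

variable (𝕜 a) in
/-- The graded normal module of the scroll. -/
abbrev Nor : Type _ :=
  ↥(scrollIdeal 𝕜 k a) →ₗ[MvPolynomial (Var a) 𝕜] (MvPolynomial (Var a) 𝕜 ⧸ scrollIdeal 𝕜 k a)

variable (𝕜 a) in
/-- The inclusion of the homogeneous coordinate ring of the scroll into the Laurent polynomials. -/
noncomputable def toLauQ :
    (MvPolynomial (Var a) 𝕜 ⧸ scrollIdeal 𝕜 k a) →ₗ[MvPolynomial (Var a) 𝕜] Lau 𝕜 k :=
  Submodule.liftQ _
    { toFun := toLau 𝕜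
      map_add' := map_add _
      map_smul' := fun x y => map_mul _ x y } fun _ hx => toLau_eq_zero_iff.2 hx

@[simp] lemma toLauQ_mk (x : MvPolynomial (Var a) 𝕜) :
    toLauQ 𝕜 a (Ideal.Quotient.mk _ x) = toLau 𝕜 x := rfl

lemma toLauQ_injective : Function.Injective (toLauQ 𝕜 a) := by
  rw [injective_iff_map_eq_zero]
  intro x hx
  obtain ⟨x, rfl⟩ := Ideal.Quotient.mk_surjective x
  exact Ideal.Quotient.eq_zero_iff_mem.2 (toLau_eq_zero_iff.1 hx)

variable (𝕜) in
/-- The minor on two columns, as an element of the ideal of the scroll. -/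
noncomputable def minorI (c c' : Col a) : ↥(scrollIdeal 𝕜 k a) :=
  ⟨minor 𝕜 c c', minorIdeal_le (Ideal.subset_span ⟨(c, c'), rfl⟩)⟩

lemma minor_isHomogeneous (c c' : Col a) : (minor 𝕜 c c').IsHomogeneous 2 :=
  ((isHomogeneous_X 𝕜 _).mul (isHomogeneous_X 𝕜 _)).sub
    ((isHomogeneous_X 𝕜 _).mul (isHomogeneous_X 𝕜 _))

lemma map_mem_of_minor {M : Type*} [AddCommGroup M] [Module (MvPolynomial (Var a) 𝕜) M]
    (f : ↥(scrollIdeal 𝕜 k a) →ₗ[MvPolynomial (Var a) 𝕜] M)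
    (W : Submodule (MvPolynomial (Var a) 𝕜) M) (h : ∀ c c', f (minorI 𝕜 c c') ∈ W)
    (x : ↥(scrollIdeal 𝕜 k a)) : f x ∈ W := by
  obtain ⟨x, hx⟩ := x
  have key : ∀ y (hy : y ∈ minorIdeal a 𝕜), f ⟨y, minorIdeal_le hy⟩ ∈ W := by
    intro y hy
    induction hy using Submodule.span_induction with
    | mem y hy =>
      obtain ⟨⟨c, c'⟩, rfl⟩ := hy
      exact h c c'
    | zero => exact (map_zero f).symm ▸ W.zero_mem
    | add y z hy hz ihy ihz =>
      have := W.add_mem ihy ihz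
      rwa [← map_add] at this
    | smul r y hy ih =>
      have := W.smul_mem r ih
      rwa [← map_smul] at this
  exact key x (scrollIdeal_eq (𝕜 := 𝕜) ▸ hx)

variable (𝕜) in
/-- The values of a homomorphism at the minors involving `c₀`, each divided by the weight of the
minor. -/
noncomputable def slope (c₀ : Col a) :
    Nor 𝕜 a →ₗ[MvPolynomial (Var a) 𝕜] (Col a → Lau 𝕜 k) where
  toFun φ c := single (-minorWt c c₀) 1 * toLauQ 𝕜 a (φ (minorI 𝕜 c c₀))
  map_add' φ ψ := by
    funext c
    simp only [LinearMap.add_apply, map_add, mul_add, Pi.add_apply]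
  map_smul' x φ := by
    funext c
    simp only [LinearMap.smul_apply, map_smul, smul_eq, RingHom.id_apply, Pi.smul_apply]
    ring

lemma slope_apply (c₀ : Col a) (φ : Nor 𝕜 a) (c : Col a) :
    slope 𝕜 c₀ φ c = single (-minorWt c c₀) 1 * toLauQ 𝕜 a (φ (minorI 𝕜 c c₀)) := rfl

lemma single_mul_cancel {u : Wt k} {f g : Lau 𝕜 k} (h : single u 1 * f = single u 1 * g) :
    f = g := by
  have := congrArg (fun x => single (-u) (1 : 𝕜) * x) h
  simpa [← mul_assoc, AddMonoidAlgebra.single_mul_single, ← AddMonoidAlgebra.one_def] using this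

lemma single_minorWt_mul_slope (c₀ : Col a) (φ : Nor 𝕜 a) (c : Col a) :
    single (minorWt c c₀) 1 * slope 𝕜 c₀ φ c = toLauQ 𝕜 a (φ (minorI 𝕜 c c₀)) := by
  simp [slope_apply, ← mul_assoc, AddMonoidAlgebra.single_mul_single, ← AddMonoidAlgebra.one_def]

lemma toLauQ_apply_minor (c₀ : Col a) (φ : Nor 𝕜 a) (c c' : Col a) :
    toLauQ 𝕜 a (φ (minorI 𝕜 c c')) =
      single (minorWt c c') 1 * (slope 𝕜 c₀ φ c - slope 𝕜 c₀ φ c') := by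
  have hsyz : (X (lo c₀) : MvPolynomial (Var a) 𝕜) • minorI 𝕜 c c' =
      (X (lo c') : MvPolynomial (Var a) 𝕜) • minorI 𝕜 c c₀ -
        (X (lo c) : MvPolynomial (Var a) 𝕜) • minorI 𝕜 c' c₀ := by
    apply Subtype.ext
    simp only [minorI, minor, Submodule.coe_smul, Submodule.coe_sub, smul_eq_mul]
    ring
  have h := congrArg (fun x => toLauQ 𝕜 a (φ x)) hsyz
  generalize hT : toLauQ 𝕜 a (φ (minorI 𝕜 c c')) = T
  simp only [map_sub, map_smul, smul_eq, toLau_X, hT, ← single_minorWt_mul_slope c₀, ← mul_assoc,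
    AddMonoidAlgebra.single_mul_single, mul_one] at h
  apply single_mul_cancel (u := wt (lo c₀))
  rw [h, ← mul_assoc, AddMonoidAlgebra.single_mul_single, mul_one, mul_sub]
  congr 3 <;> simp only [minorWt, wt_hi] <;> abel_nf

lemma slope_self (c₀ : Col a) (φ : Nor 𝕜 a) : slope 𝕜 c₀ φ c₀ = 0 := by
  have : minorI 𝕜 c₀ c₀ = 0 := by
    apply Subtype.ext
    simp only [minorI, minor, Submodule.coe_zero]
    ring
  rw [slope_apply, this, map_zero, map_zero, mul_zero]

lemma slope_injective (c₀ : Col a) : Function.Injective (slope 𝕜 c₀) := by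
  rw [injective_iff_map_eq_zero]
  intro φ h
  ext x : 1
  refine (Submodule.mem_bot _).1 (map_mem_of_minor φ ⊥ (fun c c' => ?_) x)
  rw [Submodule.mem_bot]
  apply toLauQ_injective
  rw [toLauQ_apply_minor c₀, h, map_zero]
  simp

variable (𝕜 a) in
/-- Coefficients of families of Laurent polynomials. -/
noncomputable def coeffs : (Col a → Lau 𝕜 k) ≃ₗ[𝕜] (Col a → Wt k →₀ 𝕜) :=
  LinearEquiv.piCongrRight fun _ => AddMonoidAlgebra.coeffLinearEquiv 𝕜

lemma coeffs_apply (ν : Col a → Lau 𝕜 k) (c : Col a) : coeffs 𝕜 a ν c = (ν c).coeff := rfl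

lemma coeffs_slope_mem (c₀ : Col a) {d : ℕ} {φ : Nor 𝕜 a}
    (hφ : φ ∈ normalGr 𝕜 (scrollIdeal 𝕜 k a) d) :
    coeffs 𝕜 a (slope 𝕜 c₀ φ) ∈ sections 𝕜 c₀ d (cone a) := by
  refine ⟨?_, fun c u h => ?_, fun c c' u => ?_⟩
  · rw [coeffs_apply, slope_self]; rfl
  · obtain ⟨s, hs, e⟩ := hφ 2 _ (minorI 𝕜 c c₀).2 (minor_isHomogeneous c c₀)
    have e' : toLauQ 𝕜 a (φ (minorI 𝕜 c c₀)) = toLau 𝕜 s := congrArg (toLauQ 𝕜 a) e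
    rw [coeffs_apply, slope_apply, e', AddMonoidAlgebra.coeff_single_mul_apply, one_mul] at h
    have := sum_eq_of_coeff_toLau_ne_zero hs h
    simp [Finset.sum_add_distrib] at this
    omega
  · by_cases h : coeffs 𝕜 a (slope 𝕜 c₀ φ) c u = coeffs 𝕜 a (slope 𝕜 c₀ φ) c' u
    · exact Or.inl h
    · right
      obtain ⟨s, hs⟩ := Ideal.Quotient.mk_surjective (φ (minorI 𝕜 c c'))
      apply mem_cone_of_coeff_toLau_ne_zero (𝕜 := 𝕜) (x := s)
      rw [← toLauQ_mk, hs, toLauQ_apply_minor c₀, add_comm, AddMonoidAlgebra.coeff_single_mul_add,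
        one_mul]
      simpa [sub_eq_zero, coeffs_apply] using h

variable (𝕜) in
/-- Laurent polynomials homogeneous of degree `d`. -/
noncomputable def homog (k : ℕ) (d : ℤ) : Submodule 𝕜 (Lau 𝕜 k) :=
  (Finsupp.supported 𝕜 𝕜 {u | ∑ i, u.2 i = d}).comap
    (AddMonoidAlgebra.coeffLinearEquiv 𝕜).toLinearMap

lemma mem_homog {d : ℤ} {f : Lau 𝕜 k} :
    f ∈ homog 𝕜 k d ↔ ∀ u, f.coeff u ≠ 0 → ∑ i, u.2 i = d := by
  rw [homog, Submodule.mem_comap, Finsupp.mem_supported]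
  exact forall_congr' fun u => by rw [Finset.mem_coe, Finsupp.mem_support_iff]; rfl

lemma single_mul_mem_homog {d : ℤ} {f : Lau 𝕜 k} (hf : f ∈ homog 𝕜 k d) (u : Wt k) (r : 𝕜) :
    single u r * f ∈ homog 𝕜 k (∑ i, u.2 i + d) := by
  rw [mem_homog] at hf ⊢
  intro v hv
  rw [AddMonoidAlgebra.coeff_single_mul_apply] at hv
  have := hf _ (right_ne_zero_of_mul hv)
  simp [Finset.sum_add_distrib] at this
  omega

/-- The logarithmic derivatives of the coordinates, for the vector field with slopes `ν`. -/
noncomputable def logDeriv (ν : Col a → Lau 𝕜 k) (p : Var a) : Lau 𝕜 k :=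
  ∑ j : Fin (a p.1) with j.castSucc < p.2, ν ⟨p.1, j⟩

lemma logDeriv_hi (ν : Col a → Lau 𝕜 k) (c : Col a) :
    logDeriv ν (hi c) = logDeriv ν (lo c) + ν c := by
  have : (Finset.univ.filter fun j : Fin (a c.1) => j.castSucc < (hi c).2) =
      insert c.2 (Finset.univ.filter fun j : Fin (a c.1) => j.castSucc < (lo c).2) := by
    ext j
    simp [hi, lo, le_iff_eq_or_lt]
  have e := Finset.sum_insert (f := fun j => ν ⟨c.1, j⟩) (a := c.2)
    (s := Finset.univ.filter fun j : Fin (a c.1) => j.castSucc < (lo c).2) (by simp [lo])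
  rw [← this] at e
  rw [add_comm]
  exact e

/-- The vector field with slopes `ν`. -/
noncomputable def field (ν : Col a → Lau 𝕜 k) :
    Derivation 𝕜 (MvPolynomial (Var a) 𝕜) (Lau 𝕜 k) :=
  mkDerivation 𝕜 fun p => single (wt p) 1 * logDeriv ν p

lemma field_minor (ν : Col a → Lau 𝕜 k) (c c' : Col a) :
    field ν (minor 𝕜 c c') = single (minorWt c c') 1 * (ν c - ν c') := by
  have h : single (minorWt c c') (1 : 𝕜) = single (wt (hi c)) 1 * single (wt (lo c')) 1 := by
    rw [AddMonoidAlgebra.single_mul_single, mul_one]; rfl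
  have h' : single (minorWt c c') (1 : 𝕜) = single (wt (hi c')) 1 * single (wt (lo c)) 1 := by
    rw [minorWt_comm, AddMonoidAlgebra.single_mul_single, mul_one]; rfl
  simp only [minor, map_sub, Derivation.leibniz, field, mkDerivation_X, smul_eq, toLau_X,
    logDeriv_hi]
  linear_combination (-(logDeriv ν (lo c') + logDeriv ν (lo c) + ν c)) * h +
    (logDeriv ν (lo c') + logDeriv ν (lo c) + ν c') * h'

lemma field_monomial_mem (ν : Col a → Lau 𝕜 k) {d : ℤ} (hν : ∀ c, ν c ∈ homog 𝕜 k d)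
    (s : Var a →₀ ℕ) (r : 𝕜) : field ν (monomial s r) ∈ homog 𝕜 k (s.degree + d) := by
  have key : field ν (monomial s r) = single (mwt s) r * s.sum fun p n => n • logDeriv ν p := by
    induction s using Finsupp.induction_linear generalizing r with
    | zero => 
      rw [← C_apply, ← algebraMap_eq, Derivation.map_algebraMap]
      simp
    | add s t hs ht =>
      rw [Finsupp.sum_add_index' (by simp) (by simp [add_mul]), ← mul_one r, ← monomial_mul,
        Derivation.leibniz, hs, ht, smul_eq, smul_eq, toLau_monomial, toLau_monomial, map_add,
        ← AddMonoidAlgebra.single_mul_single]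
      ring
    | single p n =>
      rw [← mul_one r, ← C_mul_monomial, ← X_pow_eq_monomial, C_mul', Derivation.map_smul,
        Derivation.leibniz_pow, Finsupp.sum_single_index (by simp), ← AddMonoidAlgebra.smul_single',
        field, mkDerivation_X, smul_eq, map_pow, toLau_X, smul_mul_assoc]
      rcases n with _ | n
      · simp
      · rw [mwt_single, AddMonoidAlgebra.single_pow, one_pow, Nat.add_sub_cancel, ← mul_assoc,
          AddMonoidAlgebra.single_mul_single, mul_one, ← succ_nsmul, mul_smul_comm]
  rw [key, ← sum_mwt]
  refine single_mul_mem_homog ?_ _ _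
  exact Submodule.sum_mem _ fun p _ => nsmul_mem (Submodule.sum_mem _ fun j _ => hν _) _

lemma field_mem (ν : Col a → Lau 𝕜 k) {d : ℤ} (hν : ∀ c, ν c ∈ homog 𝕜 k d) {n : ℕ}
    {x : MvPolynomial (Var a) 𝕜} (hx : x.IsHomogeneous n) : field ν x ∈ homog 𝕜 k (n + d) := by
  rw [← support_sum_monomial_coeff x, map_sum]
  refine Submodule.sum_mem _ fun s hs => ?_
  have h : s.degree = n := by
    rw [← hx (mem_support_iff.1 hs), Finsupp.degree_eq_weight_one]
    rfl
  have := field_monomial_mem ν hν s (coeff s x)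
  rwa [h] at this

/-- The vector field with slopes `ν` is linear on the ideal of the scroll. -/
noncomputable def fieldI (ν : Col a → Lau 𝕜 k) :
    ↥(scrollIdeal 𝕜 k a) →ₗ[MvPolynomial (Var a) 𝕜] Lau 𝕜 k where
  toFun x := field ν x
  map_add' x y := map_add (field ν) _ _
  map_smul' r x := by
    rw [Submodule.coe_smul, smul_eq_mul, Derivation.leibniz, smul_eq (x : MvPolynomial (Var a) 𝕜),
      toLau_eq_zero_iff.2 x.2, zero_mul, add_zero, RingHom.id_apply]

/-- Every section is the family of slopes of a homomorphism. -/
lemma exists_slope_eq (c₀ : Col a) {d : ℕ} {ν : Col a → Lau 𝕜 k}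
    (hν : coeffs 𝕜 a ν ∈ sections 𝕜 c₀ d (cone a)) :
    ∃ φ ∈ normalGr 𝕜 (scrollIdeal 𝕜 k a) d, slope 𝕜 c₀ φ = ν := by
  obtain ⟨h1, h2, h3⟩ := hν
  have h2' : ∀ c, ν c ∈ homog 𝕜 k d := fun c => mem_homog.2 (h2 c)
  have hmem : ∀ x, fieldI ν x ∈ LinearMap.range (toLauQ 𝕜 a) := by
    refine map_mem_of_minor _ _ fun c c' => ?_
    have e : fieldI ν (minorI 𝕜 c c') = single (minorWt c c') 1 * (ν c - ν c') :=
      field_minor ν c c'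
    obtain ⟨x, -, hx⟩ := exists_homogeneous (n := 2 + d) (a := a) (f := fieldI ν (minorI 𝕜 c c')) (by
      rw [e]
      intro u hu
      constructor
      · rw [AddMonoidAlgebra.coeff_single_mul_apply, one_mul] at hu
        have := (h3 c c' (-minorWt c c' + u)).resolve_left (by
          simpa [sub_eq_zero, coeffs_apply] using hu)
        simpa using this
      · have := mem_homog.1 (single_mul_mem_homog (sub_mem (h2' c) (h2' c')) (minorWt c c') 1) u hu
        rw [this]
        simp [Finset.sum_add_distrib])
    exact ⟨Ideal.Quotient.mk _ x, hx⟩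
  let e := LinearEquiv.ofInjective (toLauQ 𝕜 a) toLauQ_injective
  let φ : Nor 𝕜 a := e.symm.toLinearMap ∘ₗ LinearMap.codRestrict _ (fieldI ν) hmem
  have hφ : ∀ x, toLauQ 𝕜 a (φ x) = fieldI ν x := fun x =>
    congrArg Subtype.val (e.apply_symm_apply ⟨fieldI ν x, hmem x⟩)
  refine ⟨φ, fun n x hx hn => ?_, ?_⟩
  · obtain ⟨y, hy⟩ := Ideal.Quotient.mk_surjective (φ ⟨x, hx⟩)
    have hy' : toLau 𝕜 y = field ν x := by rw [← toLauQ_mk, hy, hφ]; rfl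
    obtain ⟨z, hz, hz'⟩ := exists_homogeneous (n := n + d) (a := a) (f := field ν x) fun u hu =>
      ⟨mem_cone_of_coeff_toLau_ne_zero (𝕜 := 𝕜) (x := y) (by rwa [hy']), by
        rw [mem_homog.1 (field_mem ν h2' hn) u hu]; push_cast; rfl⟩
    exact ⟨z, hz, toLauQ_injective (by rw [toLauQ_mk, hz', hφ]; rfl)⟩
  · have h0 : ν c₀ = 0 := AddMonoidAlgebra.coeff_injective h1
    funext c
    apply single_mul_cancel (u := minorWt c c₀)
    rw [single_minorWt_mul_slope, hφ]
    have := field_minor ν c c₀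
    rw [h0, sub_zero] at this
    exact this

end Normal

end Scroll

namespace Scroll

section Localization

open MvPolynomial
open AddMonoidAlgebra (single)

variable {𝕜 : Type*} [Field 𝕜] {k : ℕ} {a : Fin k → ℕ}

lemma single_neg_mul_single_mul (u : Wt k) (f : Lau 𝕜 k) :
    single (-u) 1 * (single u 1 * f) = f := by
  rw [← mul_assoc, AddMonoidAlgebra.single_mul_single, neg_add_cancel, mul_one,
    ← AddMonoidAlgebra.one_def, one_mul]

lemma isUnit_algebraMap_end {g : MvPolynomial (Var a) 𝕜} {e : Wt k} (hg : toLau 𝕜 g = single e 1)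
    (s : Submonoid.powers g) :
    IsUnit (algebraMap (MvPolynomial (Var a) 𝕜)
      (Module.End (MvPolynomial (Var a) 𝕜) (Col a → Lau 𝕜 k)) s) := by
  obtain ⟨n, hn⟩ := s.2
  have hn : g ^ n = s := hn
  rw [← hn, map_pow]
  apply IsUnit.pow
  rw [Module.End.isUnit_iff]
  constructor
  · intro μ ν h
    funext c
    apply single_mul_cancel (u := e)
    have := congrFun h c
    simpa [smul_eq, hg] using this
  · intro ν
    refine ⟨fun c => single (-e) 1 * ν c, ?_⟩
    funext c
    have := single_neg_mul_single_mul (-e) (ν c)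
    rw [neg_neg] at this
    simpa [smul_eq, hg] using this

/-- The slopes of a section over the open set where the monomial `g` does not vanish. -/
noncomputable def slopeLoc (c₀ : Col a) {g : MvPolynomial (Var a) 𝕜} {e : Wt k}
    (hg : toLau 𝕜 g = single e 1) :
    Loc (Nor 𝕜 a) g →ₗ[MvPolynomial (Var a) 𝕜] (Col a → Lau 𝕜 k) :=
  LocalizedModule.lift _ (slope 𝕜 c₀) (isUnit_algebraMap_end hg)

lemma smul_slopeLoc_mk (c₀ : Col a) {g : MvPolynomial (Var a) 𝕜} {e : Wt k}
    (hg : toLau 𝕜 g = single e 1) (φ : Nor 𝕜 a) (s : Submonoid.powers g) :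
    (s : MvPolynomial (Var a) 𝕜) • slopeLoc c₀ hg (LocalizedModule.mk φ s) = slope 𝕜 c₀ φ := by
  rw [← map_smul, LocalizedModule.smul'_mk]
  have : LocalizedModule.mk ((s : MvPolynomial (Var a) 𝕜) • φ) s =
      LocalizedModule.mkLinearMap (Submonoid.powers g) (Nor 𝕜 a) φ := LocalizedModule.mk_cancel s φ
  rw [this, slopeLoc, ← LinearMap.comp_apply, LocalizedModule.lift_comp]

lemma slopeLoc_mk (c₀ : Col a) {g : MvPolynomial (Var a) 𝕜} {e : Wt k}
    (hg : toLau 𝕜 g = single e 1) (φ : Nor 𝕜 a) (n : ℕ) (c : Col a) :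
    slopeLoc c₀ hg (LocalizedModule.mk φ
      ⟨g ^ n, Submonoid.pow_mem _ (Submonoid.mem_powers g) n⟩) c =
      single (-(n • e)) 1 * slope 𝕜 c₀ φ c := by
  rw [← smul_slopeLoc_mk c₀ hg φ ⟨g ^ n, Submonoid.pow_mem _ (Submonoid.mem_powers g) n⟩,
    Pi.smul_apply, smul_eq, map_pow, hg, AddMonoidAlgebra.single_pow, one_pow,
    single_neg_mul_single_mul]

lemma slopeLoc_injective (c₀ : Col a) {g : MvPolynomial (Var a) 𝕜} {e : Wt k}
    (hg : toLau 𝕜 g = single e 1) : Function.Injective (slopeLoc c₀ hg) := by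
  rw [injective_iff_map_eq_zero]
  intro y hy
  induction y using LocalizedModule.induction_on with
  | h φ s =>
    have := smul_slopeLoc_mk c₀ hg φ s
    rw [hy, smul_zero] at this
    rw [slope_injective c₀ (this.symm.trans (map_zero _).symm), LocalizedModule.zero_mk]

lemma slopeLoc_resMap (c₀ : Col a) {g g' : MvPolynomial (Var a) 𝕜} {e e' : Wt k}
    (hg : toLau 𝕜 g = single e 1) (hg' : toLau 𝕜 g' = single e' 1) (h : g ∣ g')
    (y : Loc (Nor 𝕜 a) g) :
    slopeLoc c₀ hg' (resMap (Nor 𝕜 a) g g' h y) = slopeLoc c₀ hg y := by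
  have : slopeLoc c₀ hg = slopeLoc c₀ hg' ∘ₗ resMap (Nor 𝕜 a) g g' h := by
    refine LocalizedModule.lift_unique _ _ _ _ ?_
    rw [LinearMap.comp_assoc, resMap, LocalizedModule.lift_comp, slopeLoc,
      LocalizedModule.lift_comp]
  rw [this, LinearMap.comp_apply]

lemma coeffs_single_mul_mem (c₀ : Col a) {d d' : ℤ} {Q Q' : Set (Wt k)} {ν : Col a → Lau 𝕜 k}
    (hν : coeffs 𝕜 a ν ∈ sections 𝕜 c₀ d Q) (v : Wt k) (hQ : ∀ u ∈ Q, u + v ∈ Q')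
    (hd : d' = ∑ i, v.2 i + d) :
    coeffs 𝕜 a (fun c => single v 1 * ν c) ∈ sections 𝕜 c₀ d' Q' := by
  obtain ⟨h1, h2, h3⟩ := hν
  refine ⟨?_, fun c => ?_, fun c c' u => ?_⟩
  · have : ν c₀ = 0 := AddMonoidAlgebra.coeff_injective h1
    simp [coeffs_apply, this]
  · rw [hd]
    exact mem_homog.1 (single_mul_mem_homog (mem_homog.2 (h2 c)) v 1)
  · rw [coeffs_apply, coeffs_apply, AddMonoidAlgebra.coeff_single_mul_apply,
      AddMonoidAlgebra.coeff_single_mul_apply, one_mul, one_mul]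
    refine (h3 c c' (-v + u)).imp id fun h => ?_
    have := hQ _ h
    rwa [show -v + u + minorWt c c' + v = u + minorWt c c' by abel] at this

lemma coeffs_slopeLoc_mem (c₀ : Col a) {g : MvPolynomial (Var a) 𝕜} {e : Wt k}
    (hg : toLau 𝕜 g = single e 1) {dg : ℕ} (he : ∑ i, e.2 i = dg) {y : Loc (Nor 𝕜 a) g}
    (hy : IsDeg (Nor 𝕜 a) (normalGr 𝕜 (scrollIdeal 𝕜 k a)) g dg 0 y) :
    coeffs 𝕜 a (slopeLoc c₀ hg y) ∈ sections 𝕜 c₀ 0 (loc a e) := by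
  obtain ⟨n, φ, hφ, rfl⟩ := hy
  have h := coeffs_single_mul_mem c₀ (d' := 0) (Q' := loc a e) (coeffs_slope_mem c₀ hφ) (-(n • e))
    (fun u hu => ⟨n, by rwa [neg_add_cancel_right]⟩) (by
      simp [← Finset.mul_sum, he, mul_comm])
  rwa [show slopeLoc c₀ hg _ = _ from funext (slopeLoc_mk c₀ hg φ n)]

lemma exists_slopeLoc_eq (c₀ : Col a) {g : MvPolynomial (Var a) 𝕜} {e : Wt k}
    (hg : toLau 𝕜 g = single e 1) (hcone : e ∈ cone a) {dg : ℕ} (he : ∑ i, e.2 i = dg)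
    {ν : Col a → Lau 𝕜 k} (hν : coeffs 𝕜 a ν ∈ sections 𝕜 c₀ 0 (loc a e)) :
    ∃ y, IsDeg (Nor 𝕜 a) (normalGr 𝕜 (scrollIdeal 𝕜 k a)) g dg 0 y ∧ slopeLoc c₀ hg y = ν := by
  classical
  obtain ⟨h1, h2, h3⟩ := hν
  have : ∀ x : Col a × Col a × Wt k, ∃ n : ℕ, coeffs 𝕜 a ν x.1 x.2.2 ≠ coeffs 𝕜 a ν x.2.1 x.2.2 →
      x.2.2 + minorWt x.1 x.2.1 + n • e ∈ cone a := by
    intro x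
    rcases h3 x.1 x.2.1 x.2.2 with h | ⟨n, h⟩
    · exact ⟨0, fun h' => absurd h h'⟩
    · exact ⟨n, fun _ => h⟩
  choose n hn using this
  let T : Finset (Wt k) := Finset.univ.biUnion fun c => (coeffs 𝕜 a ν c).support
  let N : ℕ := (Finset.univ ×ˢ Finset.univ ×ˢ T).sup n
  have h3' : coeffs 𝕜 a ν ∈ sections 𝕜 c₀ 0 {u | u + N • e ∈ cone a} := by
    refine ⟨h1, h2, fun c c' u => ?_⟩
    by_cases hne : coeffs 𝕜 a ν c u = coeffs 𝕜 a ν c' u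
    · exact Or.inl hne
    · refine Or.inr (mem_loc_of_le hcone (Finset.le_sup (f := n) (b := (c, c', u)) ?_)
        (hn (c, c', u) hne))
      have hu : u ∈ T := by
        by_contra hu
        have h0 : ∀ c, coeffs 𝕜 a ν c u = 0 := fun c => by
          by_contra hc
          exact hu (Finset.mem_biUnion.2 ⟨c, Finset.mem_univ _, Finsupp.mem_support_iff.2 hc⟩)
        exact hne (by rw [h0, h0])
      simpa using hu
  obtain ⟨φ, hφ, hφν⟩ := exists_slope_eq c₀ (d := 0 + dg * N)
    (coeffs_single_mul_mem c₀ (Q' := cone a) h3' (N • e) (fun u hu => hu) (by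
      simp [← Finset.sum_mul, he, mul_comm]))
  refine ⟨_, ⟨N, φ, hφ, rfl⟩, ?_⟩
  funext c
  rw [slopeLoc_mk, hφν, single_neg_mul_single_mul]

lemma finrank_normalDeg0 (ha : ∀ i, 1 ≤ a i) (c₀ : Col a) :
    Module.finrank 𝕜 (normalDeg0 𝕜 (scrollIdeal 𝕜 k a)) =
      ((∑ i, a i) + k) ^ 2 - k ^ 2 - 3 := by
  let f : normalDeg0 𝕜 (scrollIdeal 𝕜 k a) →ₗ[𝕜] (Col a → Wt k →₀ 𝕜) :=
    (coeffs 𝕜 a).toLinearMap ∘ₗ (slope 𝕜 c₀).restrictScalars 𝕜 ∘ₗ Submodule.subtype _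
  have hf : Function.Injective f :=
    (coeffs 𝕜 a).injective.comp ((slope_injective c₀).comp Subtype.val_injective)
  have hr : LinearMap.range f = sections 𝕜 c₀ 0 (cone a) := by
    apply le_antisymm
    · rintro _ ⟨φ, rfl⟩
      exact coeffs_slope_mem c₀ (d := 0) φ.2
    · intro μ hμ
      obtain ⟨φ, hφ, e⟩ := exists_slope_eq c₀ (d := 0) (ν := (coeffs 𝕜 a).symm μ)
        (by rw [LinearEquiv.apply_symm_apply]; exact hμ)
      exact ⟨⟨φ, hφ⟩, (congrArg (coeffs 𝕜 a) e).trans ((coeffs 𝕜 a).apply_symm_apply μ)⟩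
  rw [← LinearMap.finrank_range_of_inj hf, hr, finrank_sections ha]

end Localization

end Scroll

namespace Scroll

section Cech

open MvPolynomial
open AddMonoidAlgebra (single)

variable {𝕜 : Type*} [Field 𝕜] {k : ℕ} {a : Fin k → ℕ}

lemma toLau_X_mul_X (p q : Var a) :
    toLau 𝕜 (X p * X q : MvPolynomial (Var a) 𝕜) = single (wt p + wt q) 1 := by
  rw [map_mul, toLau_X, toLau_X, AddMonoidAlgebra.single_mul_single, one_mul]

lemma toLau_X_mul_X_mul_X (p q r : Var a) :
    toLau 𝕜 (X p * X q * X r : MvPolynomial (Var a) 𝕜) = single (wt p + wt q + wt r) 1 := by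
  rw [map_mul, toLau_X_mul_X, toLau_X, AddMonoidAlgebra.single_mul_single, one_mul]

theorem cocycle_eq_coboundary (ha : ∀ i, 1 ≤ a i) (c₀ : Col a)
    (c : (p q : Var a) → Loc (Nor 𝕜 a) (X p * X q : MvPolynomial (Var a) 𝕜))
    (hdeg : ∀ p q, IsDeg (Nor 𝕜 a) (normalGr 𝕜 (scrollIdeal 𝕜 k a)) (X p * X q) 2 0 (c p q))
    (hcocycle : ∀ p q r,
      resMap (Nor 𝕜 a) (X q * X r) (X p * X q * X r) ⟨X p, mul_rotate _ _ _⟩ (c q r)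
        - resMap (Nor 𝕜 a) (X p * X r) (X p * X q * X r) ⟨X q, mul_right_comm _ _ _⟩ (c p r)
        + resMap (Nor 𝕜 a) (X p * X q) (X p * X q * X r) ⟨X r, rfl⟩ (c p q) = 0) :
    ∃ b : (p : Var a) → Loc (Nor 𝕜 a) (X p : MvPolynomial (Var a) 𝕜),
      (∀ p, IsDeg (Nor 𝕜 a) (normalGr 𝕜 (scrollIdeal 𝕜 k a)) (X p) 1 0 (b p)) ∧
      ∀ p q, resMap (Nor 𝕜 a) (X q) (X p * X q) ⟨X p, mul_comm _ _⟩ (b q)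
        - resMap (Nor 𝕜 a) (X p) (X p * X q) ⟨X q, rfl⟩ (b p) = c p q := by
  obtain ⟨μ, hμ, hμc⟩ := exists_coboundary ha c₀
    (fun p q => coeffs 𝕜 a (slopeLoc c₀ (toLau_X_mul_X p q) (c p q)))
    (fun p q => coeffs_slopeLoc_mem c₀ _
      (by simp [Finset.sum_add_distrib]) (hdeg p q))
    (fun p q r => by
      have h := congrArg (slopeLoc c₀ (toLau_X_mul_X_mul_X p q r)) (hcocycle p q r)
      rw [map_add, map_sub, slopeLoc_resMap c₀ (toLau_X_mul_X q r),
        slopeLoc_resMap c₀ (toLau_X_mul_X p r), slopeLoc_resMap c₀ (toLau_X_mul_X p q),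
        map_zero] at h
      rw [← map_sub, ← map_add, h, map_zero])
  choose b hb hbμ using fun p => exists_slopeLoc_eq c₀ (toLau_X (𝕜 := 𝕜) p) (wt_mem_cone p)
    (dg := 1) (by simp) (ν := (coeffs 𝕜 a).symm (μ p))
    (by rw [LinearEquiv.apply_symm_apply]; exact hμ p)
  refine ⟨b, hb, fun p q => slopeLoc_injective c₀ (toLau_X_mul_X p q) ?_⟩
  rw [map_sub, slopeLoc_resMap c₀ (toLau_X q), slopeLoc_resMap c₀ (toLau_X p), hbμ, hbμ,
    ← map_sub, hμc, LinearEquiv.symm_apply_apply]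

end Cech

end Scroll

/-- Let `X ⊂ P^n` be a smooth rational normal scroll of type `(a_1, …, a_k)`, all
`aᵢ ≥ 1`, of degree `d = Σaᵢ` and dimension `k` (so `n = d + k - 1`), with homogeneous
ideal `I` and graded normal module `N = Hom(I, S/I)`.  Then
`h^0(X, N_{X/P^n}) = (d+k)^2 - k^2 - 3` (the degree-zero part of `N` has this
`𝕜`-dimension), and `H^1(X, N_{X/P^n}) = 0`: every degree-zero Čech 1-cocycle of `N`
for the affine cover `{D(z_{i,j}) ∩ X}` of `X` is a Čech coboundary. -/
theorem scroll_normal_bundle [IsAlgClosed 𝕜] (k : ℕ) (hk : 1 ≤ k) (a : Fin k → ℕ)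
    (ha : ∀ i, 1 ≤ a i) :
    Module.finrank 𝕜 (normalDeg0 𝕜 (scrollIdeal 𝕜 k a)) =
      ((∑ i, a i) + k) ^ 2 - k ^ 2 - 3 ∧
    (∀ c : (p q : (i : Fin k) × Fin (a i + 1)) →
      Loc (↥(scrollIdeal 𝕜 k a) →ₗ[MvPolynomial ((i : Fin k) × Fin (a i + 1)) 𝕜]
          (MvPolynomial ((i : Fin k) × Fin (a i + 1)) 𝕜 ⧸ scrollIdeal 𝕜 k a))
        ((X p * X q : MvPolynomial ((i : Fin k) × Fin (a i + 1)) 𝕜)),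
      (∀ p q, IsDeg (↥(scrollIdeal 𝕜 k a) →ₗ[MvPolynomial ((i : Fin k) × Fin (a i + 1)) 𝕜]
            (MvPolynomial ((i : Fin k) × Fin (a i + 1)) 𝕜 ⧸ scrollIdeal 𝕜 k a))
          (normalGr 𝕜 (scrollIdeal 𝕜 k a))
          ((X p * X q : MvPolynomial ((i : Fin k) × Fin (a i + 1)) 𝕜)) 2 0 (c p q)) →
      (∀ p q r,
        resMap (↥(scrollIdeal 𝕜 k a) →ₗ[MvPolynomial ((i : Fin k) × Fin (a i + 1)) 𝕜]
              (MvPolynomial ((i : Fin k) × Fin (a i + 1)) 𝕜 ⧸ scrollIdeal 𝕜 k a))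
            ((X q * X r : MvPolynomial ((i : Fin k) × Fin (a i + 1)) 𝕜)) (X p * X q * X r)
            ⟨X p, mul_rotate _ _ _⟩ (c q r)
          - resMap (↥(scrollIdeal 𝕜 k a) →ₗ[MvPolynomial ((i : Fin k) × Fin (a i + 1)) 𝕜]
              (MvPolynomial ((i : Fin k) × Fin (a i + 1)) 𝕜 ⧸ scrollIdeal 𝕜 k a))
            ((X p * X r : MvPolynomial ((i : Fin k) × Fin (a i + 1)) 𝕜)) (X p * X q * X r)
            ⟨X q, mul_right_comm _ _ _⟩ (c p r)
          + resMap (↥(scrollIdeal 𝕜 k a) →ₗ[MvPolynomial ((i : Fin k) × Fin (a i + 1)) 𝕜]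
              (MvPolynomial ((i : Fin k) × Fin (a i + 1)) 𝕜 ⧸ scrollIdeal 𝕜 k a))
            ((X p * X q : MvPolynomial ((i : Fin k) × Fin (a i + 1)) 𝕜)) (X p * X q * X r)
            ⟨X r, rfl⟩ (c p q) = 0) →
      ∃ b : (p : (i : Fin k) × Fin (a i + 1)) →
          Loc (↥(scrollIdeal 𝕜 k a) →ₗ[MvPolynomial ((i : Fin k) × Fin (a i + 1)) 𝕜]
              (MvPolynomial ((i : Fin k) × Fin (a i + 1)) 𝕜 ⧸ scrollIdeal 𝕜 k a))
            ((X p : MvPolynomial ((i : Fin k) × Fin (a i + 1)) 𝕜)),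
        (∀ p, IsDeg (↥(scrollIdeal 𝕜 k a) →ₗ[MvPolynomial ((i : Fin k) × Fin (a i + 1)) 𝕜]
              (MvPolynomial ((i : Fin k) × Fin (a i + 1)) 𝕜 ⧸ scrollIdeal 𝕜 k a))
            (normalGr 𝕜 (scrollIdeal 𝕜 k a))
            ((X p : MvPolynomial ((i : Fin k) × Fin (a i + 1)) 𝕜)) 1 0 (b p)) ∧
        ∀ p q,
          resMap (↥(scrollIdeal 𝕜 k a) →ₗ[MvPolynomial ((i : Fin k) × Fin (a i + 1)) 𝕜]
                (MvPolynomial ((i : Fin k) × Fin (a i + 1)) 𝕜 ⧸ scrollIdeal 𝕜 k a))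
              ((X q : MvPolynomial ((i : Fin k) × Fin (a i + 1)) 𝕜)) (X p * X q)
              ⟨X p, mul_comm _ _⟩ (b q)
            - resMap (↥(scrollIdeal 𝕜 k a) →ₗ[MvPolynomial ((i : Fin k) × Fin (a i + 1)) 𝕜]
                (MvPolynomial ((i : Fin k) × Fin (a i + 1)) 𝕜 ⧸ scrollIdeal 𝕜 k a))
              ((X p : MvPolynomial ((i : Fin k) × Fin (a i + 1)) 𝕜)) (X p * X q)
              ⟨X q, rfl⟩ (b p) = c p q) := by
  exact ⟨Scroll.finrank_normalDeg0 ha ⟨⟨0, hk⟩, ⟨0, ha _⟩⟩,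
    Scroll.cocycle_eq_coboundary ha ⟨⟨0, hk⟩, ⟨0, ha _⟩⟩⟩
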